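/- arXiv:1911.06054 — 10 statements merged into one kernel-verified Lean document; each statement's English description precedes it below -/
import Mathlib

section
/- For every integer n ≥ 3, the dihedral group D_{2n} of order 2n is a CG-group. -/
/-- The set of element centralizers of a group `G`. -/
def Cent (G : Type*) [Group G] : Set (Subgroup G) :=
  Set.range fun x : G => Subgroup.centralizer {x}

/-- A finite group `G` is a CG-group if `|Cent(G)| = |G'| + 2`,
where `G'` is the commutator subgroup. -/
def IsCGGroup (G : Type*) [Group G] : Prop :=
  (Cent G).ncard = Nat.card (commutator G) + 2

theorem Set.ncard_range_congr {α β γ : Type*} {f : α → β} {g : α → γ}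
    (h : ∀ a b, f a = f b ↔ g a = g b) : (Set.range f).ncard = (Set.range g).ncard := by
  have hker : Setoid.ker f = Setoid.ker g := Setoid.ext h
  exact Nat.card_congr <| (Setoid.quotientKerEquivRange f).symm.trans <|
    (Quotient.congr (Equiv.refl α) fun a b => h a b).trans (Setoid.quotientKerEquivRange g)

namespace DihedralGroup

variable {n : ℕ}

/-- The subgroup of squares of rotations. -/
def evenRotations (n : ℕ) : Subgroup (DihedralGroup n) where
  carrier := r '' Set.range fun i : ZMod n => i + i
  one_mem' := ⟨0, ⟨0, by simp⟩, rfl⟩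
  mul_mem' := by
    rintro _ _ ⟨_, ⟨i, rfl⟩, rfl⟩ ⟨_, ⟨j, rfl⟩, rfl⟩
    exact ⟨_, ⟨i + j, rfl⟩, by rw [r_mul_r]; congr 1; ring⟩
  inv_mem' := by
    rintro _ ⟨_, ⟨i, rfl⟩, rfl⟩
    exact ⟨_, ⟨-i, rfl⟩, by rw [inv_r]; congr 1; ring⟩

open scoped commutatorElement in
theorem commutator_eq_evenRotations : commutator (DihedralGroup n) = evenRotations n := by
  apply le_antisymm
  · rw [commutator_def, Subgroup.commutator_le]
    rintro (i | i) - (j | j) -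
    · exact ⟨_, ⟨0, rfl⟩, by simp [commutatorElement_def]⟩
    · exact ⟨_, ⟨i, rfl⟩, by simp [commutatorElement_def]; ring⟩
    · exact ⟨_, ⟨-j, rfl⟩, by simp [commutatorElement_def]⟩
    · exact ⟨_, ⟨j - i, rfl⟩, by simp [commutatorElement_def]; ring⟩
  · rintro _ ⟨_, ⟨i, rfl⟩, rfl⟩
    have h : r (i + i) = ⁅(r i : DihedralGroup n), sr 0⁆ := by simp [commutatorElement_def]
    rw [h]
    exact Subgroup.commutator_mem_commutator (Subgroup.mem_top _) (Subgroup.mem_top _)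

theorem card_commutator :
    Nat.card (commutator (DihedralGroup n)) = (Set.range fun i : ZMod n => i + i).ncard := by
  rw [commutator_eq_evenRotations]
  exact Set.ncard_image_of_injective _ fun i j h => r.inj h

theorem r_mem_centralizer_r (i j : ZMod n) : r j ∈ Subgroup.centralizer {r i} := by
  simp [Subgroup.mem_centralizer_singleton_iff, add_comm]

theorem sr_mem_centralizer_r (i j : ZMod n) :
    sr j ∈ Subgroup.centralizer {r i} ↔ i + i = 0 := by
  simp only [Subgroup.mem_centralizer_singleton_iff, r_mul_sr, sr_mul_r, sr.injEq]
  constructor <;> intro h <;> linear_combination h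

theorem r_mem_centralizer_sr (i j : ZMod n) :
    r j ∈ Subgroup.centralizer {sr i} ↔ j + j = 0 := by
  simp only [Subgroup.mem_centralizer_singleton_iff, r_mul_sr, sr_mul_r, sr.injEq]
  constructor <;> intro h <;> linear_combination -h

theorem sr_mem_centralizer_sr (i j : ZMod n) :
    sr j ∈ Subgroup.centralizer {sr i} ↔ i + i = j + j := by
  simp only [Subgroup.mem_centralizer_singleton_iff, sr_mul_sr, r.injEq]
  constructor <;> intro h <;> linear_combination h

theorem centralizer_r_of_add_self_eq_zero {i : ZMod n} (hi : i + i = 0) :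
    Subgroup.centralizer {r i} = ⊤ := by
  ext (j | j)
  · simp [r_mem_centralizer_r]
  · simp [sr_mem_centralizer_r, hi]

theorem centralizer_r_eq_centralizer_r {i k : ZMod n} (hi : i + i ≠ 0) (hk : k + k ≠ 0) :
    Subgroup.centralizer {r i} = Subgroup.centralizer {r k} := by
  ext (j | j)
  · simp [r_mem_centralizer_r]
  · simp [sr_mem_centralizer_r, hi, hk]

theorem centralizer_sr_eq_centralizer_sr_iff (i k : ZMod n) :
    Subgroup.centralizer {sr i} = Subgroup.centralizer {sr k} ↔ i + i = k + k := by
  constructor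
  · intro h
    rw [← sr_mem_centralizer_sr, h, sr_mem_centralizer_sr]
  · intro h
    ext (j | j)
    · simp [r_mem_centralizer_sr]
    · simp [sr_mem_centralizer_sr, h]

theorem cent_eq_insert (h : (1 : ZMod n) + 1 ≠ 0) :
    Cent (DihedralGroup n) = insert ⊤ (insert (Subgroup.centralizer {r 1})
      (Set.range fun i : ZMod n => Subgroup.centralizer {sr i})) := by
  apply Set.Subset.antisymm
  · rintro _ ⟨i | i, rfl⟩
    · by_cases hi : i + i = 0
      · exact Or.inl (centralizer_r_of_add_self_eq_zero hi)
      · exact Or.inr (Or.inl (centralizer_r_eq_centralizer_r hi h))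
    · exact Or.inr (Or.inr ⟨i, rfl⟩)
  · rintro _ (rfl | rfl | ⟨i, rfl⟩)
    · exact ⟨r 0, centralizer_r_of_add_self_eq_zero (add_zero 0)⟩
    · exact ⟨r 1, rfl⟩
    · exact ⟨sr i, rfl⟩

theorem ncard_cent [NeZero n] (h : (1 : ZMod n) + 1 ≠ 0) :
    (Cent (DihedralGroup n)).ncard = (Set.range fun i : ZMod n => i + i).ncard + 2 := by
  have hrange : Subgroup.centralizer {r 1} ∉
      Set.range fun i : ZMod n => Subgroup.centralizer {sr i} := by
    rintro ⟨i, hi⟩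
    exact h ((r_mem_centralizer_sr i 1).1 (SetLike.ext_iff.1 hi (r 1) |>.2
      (r_mem_centralizer_r 1 1)))
  have htop : (⊤ : Subgroup (DihedralGroup n)) ∉ insert (Subgroup.centralizer {r 1})
      (Set.range fun i : ZMod n => Subgroup.centralizer {sr i}) := by
    rintro (h1 | ⟨i, hi⟩)
    · exact h ((sr_mem_centralizer_r 1 0).1 (h1 ▸ Subgroup.mem_top _))
    · exact h ((r_mem_centralizer_sr i 1).1 (SetLike.ext_iff.1 hi (r 1) |>.2
        (Subgroup.mem_top _)))
  rw [cent_eq_insert h, Set.ncard_insert_of_notMem htop (Set.toFinite _),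
    Set.ncard_insert_of_notMem hrange (Set.toFinite _),
    Set.ncard_range_congr centralizer_sr_eq_centralizer_sr_iff]

end DihedralGroup

theorem dihedral_isCGGroup (n : ℕ) (hn : 3 ≤ n) : IsCGGroup (DihedralGroup n) := by
  have : NeZero n := ⟨by omega⟩
  have h : (1 : ZMod n) + 1 ≠ 0 := by
    intro h
    have h2 : ((2 : ℕ) : ZMod n) = 0 := by
      rw [← h]; norm_num
    have := Nat.le_of_dvd two_pos ((ZMod.natCast_eq_zero_iff 2 n).1 h2)
    omega
  rw [IsCGGroup, DihedralGroup.ncard_cent h, DihedralGroup.card_commutator]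
end

section
/- For every integer m ≥ 2, the generalized quaternion (dicyclic) group Q_{4m} = ⟨a, b | a^{2m} = 1, b² = a^m, b a b⁻¹ = a⁻¹⟩ of order 4m is a CG-group. -/
theorem Set.ncard_range_eq_of_eq_iff {α β γ : Type*} {f : α → β} {g : α → γ}
    (h : ∀ x y, f x = f y ↔ g x = g y) : (Set.range f).ncard = (Set.range g).ncard := by
  have hk : Setoid.ker f = Setoid.ker g := Setoid.ext h
  rw [← Nat.card_coe_set_eq, ← Nat.card_coe_set_eq,
    ← Nat.card_congr (Setoid.quotientKerEquivRange f),
    ← Nat.card_congr (Setoid.quotientKerEquivRange g), hk]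

namespace QuaternionGroup

variable {n : ℕ}

theorem a_inv (i : ZMod (2 * n)) : (a i)⁻¹ = a (-i) := rfl

theorem xa_inv (i : ZMod (2 * n)) : (xa i)⁻¹ = xa ((n : ZMod (2 * n)) + i) := rfl

theorem a_mem_centralizer_a (i j : ZMod (2 * n)) :
    a j ∈ Subgroup.centralizer {a i} := by
  simp [Subgroup.mem_centralizer_singleton_iff, add_comm]

theorem xa_mem_centralizer_a {i j : ZMod (2 * n)} :
    xa j ∈ Subgroup.centralizer {a i} ↔ 2 * i = 0 := by
  simp only [Subgroup.mem_centralizer_singleton_iff, a_mul_xa, xa_mul_a, xa.injEq]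
  grind

theorem a_mem_centralizer_xa {i j : ZMod (2 * n)} :
    a j ∈ Subgroup.centralizer {xa i} ↔ 2 * j = 0 := by
  simp only [Subgroup.mem_centralizer_singleton_iff, a_mul_xa, xa_mul_a, xa.injEq]
  grind

theorem xa_mem_centralizer_xa {i j : ZMod (2 * n)} :
    xa j ∈ Subgroup.centralizer {xa i} ↔ 2 * i = 2 * j := by
  simp only [Subgroup.mem_centralizer_singleton_iff, xa_mul_xa, a.injEq]
  grind

theorem centralizer_xa_eq_iff (i j : ZMod (2 * n)) :
    Subgroup.centralizer {xa i} = Subgroup.centralizer {xa j} ↔ 2 * i = 2 * j := by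
  refine ⟨fun h => ?_, fun h => ?_⟩
  · rw [← xa_mem_centralizer_xa, h, xa_mem_centralizer_xa]
  · ext (k | k)
    · simp only [a_mem_centralizer_xa]
    · simp only [xa_mem_centralizer_xa, h]

theorem centralizer_a_of_two_mul_eq_zero {i : ZMod (2 * n)} (hi : 2 * i = 0) :
    Subgroup.centralizer {a i} = ⊤ := by
  ext (k | k)
  · simp [a_mem_centralizer_a]
  · simp [xa_mem_centralizer_a, hi]

theorem centralizer_a_of_two_mul_ne_zero {i j : ZMod (2 * n)} (hi : 2 * i ≠ 0)
    (hj : 2 * j ≠ 0) : Subgroup.centralizer {a i} = Subgroup.centralizer {a j} := by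
  ext (k | k)
  · simp [a_mem_centralizer_a]
  · simp [xa_mem_centralizer_a, hi, hj]

theorem cent_eq (h : (2 : ZMod (2 * n)) ≠ 0) :
    Cent (QuaternionGroup n) = insert ⊤ (insert (Subgroup.centralizer {a 1})
      (Set.range fun i : ZMod (2 * n) => Subgroup.centralizer {xa i})) := by
  ext H
  simp only [Cent, Set.mem_range, Set.mem_insert_iff]
  constructor
  · rintro ⟨i | i, rfl⟩
    · by_cases hi : 2 * i = 0
      · exact Or.inl (centralizer_a_of_two_mul_eq_zero hi)
      · exact Or.inr (Or.inl (centralizer_a_of_two_mul_ne_zero hi (by simpa using h)))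
    · exact Or.inr (Or.inr ⟨i, rfl⟩)
  · rintro (rfl | rfl | ⟨i, rfl⟩)
    · exact ⟨a 0, centralizer_a_of_two_mul_eq_zero (mul_zero 2)⟩
    · exact ⟨a 1, rfl⟩
    · exact ⟨xa i, rfl⟩

/-- The subgroup of even powers of the cyclic generator `a 1`. -/
def evenRotations (n : ℕ) : Subgroup (QuaternionGroup n) where
  carrier := Set.range fun i : ZMod (2 * n) => a (2 * i)
  mul_mem' := by
    rintro _ _ ⟨i, rfl⟩ ⟨j, rfl⟩
    exact ⟨i + j, by simp [mul_add]⟩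
  one_mem' := ⟨0, by simp⟩
  inv_mem' := by
    rintro _ ⟨i, rfl⟩
    exact ⟨-i, by simp [a_inv]⟩

theorem commutator_eq_evenRotations : commutator (QuaternionGroup n) = evenRotations n := by
  have hn : (2 * (n : ZMod (2 * n))) = 0 := by norm_cast; simp
  apply le_antisymm
  · rw [commutator_def, Subgroup.commutator_le]
    rintro (i | i) - (j | j) -
    · exact ⟨0, by simp [commutatorElement_def, a_inv]⟩
    · refine ⟨i, ?_⟩
      simp only [commutatorElement_def, a_inv, xa_inv, a_mul_xa, xa_mul_a, xa_mul_xa, a.injEq]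
      grind
    · refine ⟨-j, ?_⟩
      simp only [commutatorElement_def, a_inv, xa_inv, a_mul_a, xa_mul_a, xa_mul_xa, a.injEq]
      grind
    · refine ⟨j - i, ?_⟩
      simp only [commutatorElement_def, xa_inv, a_mul_xa, xa_mul_xa, a.injEq]
      grind
  · rintro _ ⟨i, rfl⟩
    have h := Subgroup.commutator_mem_commutator (Subgroup.mem_top (a i))
      (Subgroup.mem_top (xa (0 : ZMod (2 * n))))
    rw [← commutator_def] at h
    convert h using 1
    simp only [commutatorElement_def, a_inv, xa_inv, a_mul_xa, xa_mul_a, xa_mul_xa, a.injEq]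
    grind

end QuaternionGroup

/-- The generalized quaternion (dicyclic) group `Q_{4m}` of order `4m`, `m ≥ 2`,
is a CG-group. -/
theorem quaternionGroup_isCGGroup (m : ℕ) (hm : 2 ≤ m) :
    IsCGGroup (QuaternionGroup m) := by
  have : NeZero m := ⟨by lia⟩
  have h2 : (2 : ZMod (2 * m)) ≠ 0 := by
    intro h
    have := Nat.le_of_dvd two_pos ((ZMod.natCast_eq_zero_iff 2 (2 * m)).1 (mod_cast h))
    lia
  have h2' : (2 : ZMod (2 * m)) * 1 ≠ 0 := by simpa using h2
  have hfin : (Set.range fun i : ZMod (2 * m) =>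
      Subgroup.centralizer {QuaternionGroup.xa i}).Finite := Set.finite_range _
  have hA : Subgroup.centralizer {QuaternionGroup.a (1 : ZMod (2 * m))} ∉
      Set.range fun i : ZMod (2 * m) => Subgroup.centralizer {QuaternionGroup.xa i} := by
    rintro ⟨i, hi⟩
    exact h2' (QuaternionGroup.a_mem_centralizer_xa.1
      (hi.symm ▸ QuaternionGroup.a_mem_centralizer_a 1 1))
  have htop : ⊤ ∉ insert (Subgroup.centralizer {QuaternionGroup.a (1 : ZMod (2 * m))})
      (Set.range fun i : ZMod (2 * m) => Subgroup.centralizer {QuaternionGroup.xa i}) := by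
    rintro (h | ⟨i, hi⟩)
    · exact h2' (QuaternionGroup.xa_mem_centralizer_a.1
        (h ▸ Subgroup.mem_top (QuaternionGroup.xa 0)))
    · exact h2' (QuaternionGroup.a_mem_centralizer_xa.1
        (hi.symm ▸ Subgroup.mem_top (QuaternionGroup.a 1)))
  have hcard : Nat.card (QuaternionGroup.evenRotations m) =
      (Set.range fun i : ZMod (2 * m) => QuaternionGroup.a (2 * i)).ncard :=
    Nat.card_coe_set_eq _
  rw [IsCGGroup, QuaternionGroup.cent_eq h2, Set.ncard_insert_of_notMem htop (hfin.insert _),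
    Set.ncard_insert_of_notMem hA hfin, QuaternionGroup.commutator_eq_evenRotations, hcard,
    Set.ncard_range_eq_of_eq_iff fun i j => ?_]
  rw [QuaternionGroup.centralizer_xa_eq_iff, QuaternionGroup.a.injEq]
end

section
/- Let G be a finite group such that the intersection of the commutator subgroup G' with the center Z(G) is trivial. Then G is a CG-group if and only if the quotient group G/Z(G) is a CG-group. -/
section SurjectiveHom

variable {G H : Type*} [Group G] [Group H] {f : G →* H}

/-- If `f.ker` meets the commutator subgroup trivially, then `f` reflects commutation of
elements, so element centralizers are pulled back from element centralizers. -/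
theorem comap_centralizer_singleton_of_disjoint (h : Disjoint (commutator G) f.ker) (x : G) :
    (Subgroup.centralizer {f x}).comap f = Subgroup.centralizer {x} := by
  ext y
  simp only [Subgroup.mem_comap, Subgroup.mem_centralizer_singleton_iff]
  refine ⟨fun hxy => ?_, fun hxy => by rw [← map_mul, hxy, map_mul]⟩
  rw [← commutatorElement_eq_one_iff_mul_comm]
  refine Subgroup.disjoint_def.mp h ?_ ?_
  · exact Subgroup.commutator_mem_commutator (Subgroup.mem_top _) (Subgroup.mem_top _)
  · rw [MonoidHom.mem_ker, map_commutatorElement, commutatorElement_eq_one_iff_mul_comm]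
    exact hxy

theorem ncard_Cent_eq_of_surjective (hf : Function.Surjective f)
    (h : Disjoint (commutator G) f.ker) : (Cent G).ncard = (Cent H).ncard := by
  have hCent : Cent G = Subgroup.comap f '' Cent H := by
    rw [Cent, Cent, ← hf.range_comp, ← Set.range_comp]
    exact congrArg Set.range
      (funext fun x => (comap_centralizer_singleton_of_disjoint h x).symm)
  rw [hCent, Set.ncard_image_of_injective _ (Subgroup.comap_injective hf)]

theorem card_commutator_eq_of_surjective (hf : Function.Surjective f)
    (h : Disjoint (commutator G) f.ker) :
    Nat.card (commutator G) = Nat.card (commutator H) := by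
  have hmap : (commutator G).map f = commutator H := by
    rw [commutator_def, commutator_def, Subgroup.map_commutator,
      Subgroup.map_top_of_surjective f hf]
  have hinj : Function.Injective (f.subgroupMap (commutator G)) := by
    refine (injective_iff_map_eq_one _).mpr fun x hx => Subtype.ext ?_
    exact Subgroup.disjoint_def.mp h x.2 (congrArg Subtype.val hx)
  rw [← hmap]
  exact Nat.card_eq_of_bijective _ ⟨hinj, f.subgroupMap_surjective _⟩

theorem isCGGroup_iff_of_surjective (hf : Function.Surjective f)
    (h : Disjoint (commutator G) f.ker) : IsCGGroup G ↔ IsCGGroup H := by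
  rw [IsCGGroup, IsCGGroup, ncard_Cent_eq_of_surjective hf h,
    card_commutator_eq_of_surjective hf h]

end SurjectiveHom

/-- If `G' ∩ Z(G)` is trivial, then `G` is a CG-group iff `G/Z(G)` is a CG-group. -/
theorem isCGGroup_iff_quotient_center (G : Type*) [Group G] [Finite G]
    (h : commutator G ⊓ Subgroup.center G = ⊥) :
    IsCGGroup G ↔ IsCGGroup (G ⧸ Subgroup.center G) := by
  refine isCGGroup_iff_of_surjective (QuotientGroup.mk'_surjective (Subgroup.center G)) ?_
  rw [QuotientGroup.ker_mk', disjoint_iff]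
  exact h
end

section
/- Let G be a group such that |G/Z(G)| = p·q·r, where p, q, r are primes (not necessarily distinct). Then the centralizer C_G(x) is abelian for every element x ∈ G that does not lie in Z(G). -/
/-- Along a strict inclusion of subgroups of finite index, the number of prime factors of the
index (counted with multiplicity) strictly decreases. -/
theorem Subgroup.cardFactors_index_lt_of_lt {G : Type*} [Group G] {H K : Subgroup G}
    (h : H < K) (hH : H.index ≠ 0) :
    ArithmeticFunction.cardFactors K.index < ArithmeticFunction.cardFactors H.index := by
  rw [← Subgroup.relIndex_mul_index h.le] at hH ⊢
  obtain ⟨hrel, hK⟩ := mul_ne_zero_iff.mp hH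
  rw [ArithmeticFunction.cardFactors_mul hrel hK]
  have hpos : ArithmeticFunction.cardFactors (H.relIndex K) ≠ 0 := by
    rw [Ne, ArithmeticFunction.cardFactors_eq_zero_iff_eq_zero_or_one, not_or]
    exact ⟨hrel, fun h1 => h.not_ge (Subgroup.relIndex_eq_one.mp h1)⟩
  omega

/-- If `|G/Z(G)| = p·q·r` for primes `p, q, r` (not necessarily distinct), then the
centralizer of every noncentral element of `G` is abelian. -/
theorem centralizer_abelian_of_card_quotient_center_eq_pqr
    (G : Type*) [Group G] (p q r : ℕ) (hp : p.Prime) (hq : q.Prime) (hr : r.Prime)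
    (hcard : Nat.card (G ⧸ Subgroup.center G) = p * q * r) :
    ∀ x : G, x ∉ Subgroup.center G →
      ∀ a ∈ Subgroup.centralizer ({x} : Set G), ∀ b ∈ Subgroup.centralizer ({x} : Set G),
        a * b = b * a := by
  intro x hx a ha b hb
  by_contra hab
  set C := Subgroup.centralizer ({x} : Set G) with hC
  have hxC : x ∈ C := Subgroup.mem_centralizer_singleton_iff.mpr rfl
  have hZ : Subgroup.center G < Subgroup.centralizer (C : Set G) ⊓ C := by
    refine SetLike.lt_iff_le_and_exists.mpr
      ⟨le_inf (Subgroup.center_le_centralizer _) (Subgroup.center_le_centralizer _), x, ?_, hx⟩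
    refine ⟨Subgroup.mem_centralizer_iff.mpr fun c hc => ?_, hxC⟩
    exact Subgroup.mem_centralizer_singleton_iff.mp hc
  have hD : Subgroup.centralizer (C : Set G) ⊓ C < Subgroup.centralizer {a} ⊓ C := by
    refine SetLike.lt_iff_le_and_exists.mpr
      ⟨inf_le_inf_right _ (Subgroup.centralizer_le (Set.singleton_subset_iff.mpr ha)), a,
        Subgroup.mem_inf.mpr ⟨Subgroup.mem_centralizer_singleton_iff.mpr rfl, ha⟩, fun h => hab ?_⟩
    exact (Subgroup.mem_centralizer_iff.mp h.1 b hb).symm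
  have hE : Subgroup.centralizer {a} ⊓ C < C := by
    refine SetLike.lt_iff_le_and_exists.mpr ⟨inf_le_right, b, hb, fun h => hab ?_⟩
    exact (Subgroup.mem_centralizer_singleton_iff.mp h.1).symm
  have hT : C < ⊤ := by
    refine lt_top_iff_ne_top.mpr fun h => hx ?_
    refine Subgroup.mem_center_iff.mpr fun g => ?_
    exact Subgroup.mem_centralizer_singleton_iff.mp (hC ▸ h ▸ Subgroup.mem_top g)
  have hindex : (Subgroup.center G).index = p * q * r := hcard
  have hpq : p * q ≠ 0 := mul_ne_zero hp.ne_zero hq.ne_zero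
  have h0 : (Subgroup.center G).index ≠ 0 := hindex ▸ mul_ne_zero hpq hr.ne_zero
  have hfin {K : Subgroup G} (h : Subgroup.center G ≤ K) : K.index ≠ 0 :=
    fun hK => h0 (Nat.eq_zero_of_zero_dvd (hK ▸ Subgroup.index_dvd_of_le h))
  have h1 := Subgroup.cardFactors_index_lt_of_lt hZ h0
  have h2 := Subgroup.cardFactors_index_lt_of_lt hD (hfin hZ.le)
  have h3 := Subgroup.cardFactors_index_lt_of_lt hE (hfin (hZ.trans hD).le)
  have h4 := Subgroup.cardFactors_index_lt_of_lt hT (hfin ((hZ.trans hD).trans hE).le)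
  rw [hindex, ArithmeticFunction.cardFactors_mul hpq hr.ne_zero,
    ArithmeticFunction.cardFactors_mul hp.ne_zero hq.ne_zero,
    ArithmeticFunction.cardFactors_apply_prime hp, ArithmeticFunction.cardFactors_apply_prime hq,
    ArithmeticFunction.cardFactors_apply_prime hr] at h1
  omega
end

section
/- Let G be a finite group such that the quotient G/Z(G) is perfect (i.e., G/Z(G) equals its own commutator subgroup). Then G is not a CG-group. -/
/-- Elements that agree modulo the center have the same centralizer. -/
theorem centralizer_singleton_eq_of_inv_mul_mem_center {G : Type*} [Group G] {x y : G}
    (hxy : x⁻¹ * y ∈ Subgroup.center G) :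
    Subgroup.centralizer {x} = Subgroup.centralizer {y} := by
  obtain ⟨z, rfl⟩ : ∃ z, y = x * z := ⟨x⁻¹ * y, by group⟩
  rw [inv_mul_cancel_left, Subgroup.mem_center_iff] at hxy
  ext g
  simp only [Subgroup.mem_centralizer_singleton_iff]
  rw [← mul_assoc, mul_assoc x z g, ← hxy g, ← mul_assoc x g z, mul_left_inj]

/-- If `G/Z(G)` is perfect, then every element centralizer is the centralizer of an element of
the commutator subgroup. -/
theorem Cent_subset_image_commutator {G : Type*} [Group G]
    (h : commutator (G ⧸ Subgroup.center G) = ⊤) :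
    Cent G ⊆ (fun x : G => Subgroup.centralizer {x}) '' (commutator G : Set G) := by
  rintro _ ⟨x, rfl⟩
  have hmap : (commutator G).map (QuotientGroup.mk' (Subgroup.center G)) = ⊤ := by
    rw [commutator_def, Subgroup.map_commutator,
      Subgroup.map_top_of_surjective _ (QuotientGroup.mk'_surjective _), ← commutator_def, h]
  obtain ⟨g, hg, hgx⟩ := Subgroup.mem_map.mp
    (hmap ▸ Subgroup.mem_top (QuotientGroup.mk' (Subgroup.center G) x))
  exact ⟨g, hg, centralizer_singleton_eq_of_inv_mul_mem_center (QuotientGroup.eq.mp hgx)⟩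

/-- If `G/Z(G)` is perfect, then `G` is not a CG-group. -/
theorem not_isCGGroup_of_quotient_center_perfect (G : Type*) [Group G] [Finite G]
    (h : commutator (G ⧸ Subgroup.center G) = ⊤) :
    ¬ IsCGGroup G := by
  intro hG
  have hle : (Cent G).ncard ≤ Nat.card (commutator G) :=
    (Set.ncard_le_ncard (Cent_subset_image_commutator h) (Set.toFinite _)).trans
      (Set.ncard_image_le (Set.toFinite _))
  rw [IsCGGroup] at hG
  omega
end

section
/- Let G be a finite non-abelian group that has an abelian normal subgroup of prime index. Then G is a CG-group. -/
namespace Subgroup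

open scoped commutatorElement

variable {G : Type*} [Group G] {N : Subgroup G}

/-- A subgroup of prime index is maximal. -/
theorem eq_top_of_index_prime (hidx : N.index.Prime) {H : Subgroup G} (hNH : N ≤ H) {x : G}
    (hxN : x ∉ N) (hxH : x ∈ H) : H = ⊤ := by
  rw [← relIndex_mul_index hNH, Nat.prime_mul_iff] at hidx
  rcases hidx with ⟨-, h⟩ | ⟨-, h⟩
  · exact index_eq_one.mp h
  · exact absurd (relIndex_eq_one.mp h hxH) hxN

theorem exists_notMem_of_index_prime (hidx : N.index.Prime) : ∃ t, t ∉ N := by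
  by_contra! h
  rw [(eq_top_iff' N).mpr h, index_top] at hidx
  exact Nat.not_prime_one hidx

/-- If `N` is normal of prime index, every element of `G` lies in `N` times a power of any
fixed element outside `N`. -/
theorem exists_mul_zpow_eq (hN : N.Normal) (hidx : N.index.Prime) {x : G} (hxN : x ∉ N) (g : G) :
    ∃ n ∈ N, ∃ k : ℤ, n * x ^ k = g := by
  have hg : g ∈ N ⊔ zpowers x := by
    rw [eq_top_of_index_prime hidx le_sup_left hxN (mem_sup_right (mem_zpowers x))]
    exact mem_top g
  obtain ⟨n, hn, y, ⟨k, rfl⟩, h⟩ := mem_sup_of_normal_left.mp hg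
  exact ⟨n, hn, k, h⟩

theorem mem_center_of_commute (hab : ∀ x ∈ N, ∀ y ∈ N, x * y = y * x) (hidx : N.index.Prime)
    {x z : G} (hxN : x ∉ N) (hz : z ∈ N) (hzx : Commute z x) : z ∈ center G := by
  have h : centralizer {z} = ⊤ :=
    eq_top_of_index_prime hidx
      (fun n hn => mem_centralizer_singleton_iff.mpr (hab n hn z hz)) hxN
      (mem_centralizer_singleton_iff.mpr hzx.symm.eq)
  exact mem_center_iff.mpr fun g => mem_centralizer_singleton_iff.mp (h ▸ mem_top g)

theorem exists_mem_center_mul_zpow_eq (hN : N.Normal)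
    (hab : ∀ x ∈ N, ∀ y ∈ N, x * y = y * x) (hidx : N.index.Prime) {x y : G} (hxN : x ∉ N)
    (hy : Commute y x) : ∃ z ∈ center G, ∃ k : ℤ, z * x ^ k = y := by
  obtain ⟨n, hn, k, rfl⟩ := exists_mul_zpow_eq hN hidx hxN y
  refine ⟨n, mem_center_of_commute hab hidx hxN hn ?_, k, rfl⟩
  have h := hy.mul_left ((Commute.refl x).zpow_left (-k))
  rwa [zpow_neg, mul_inv_cancel_right] at h

/-- Centralizers of elements outside `N` are abelian. -/
theorem commute_of_commute (hN : N.Normal) (hab : ∀ x ∈ N, ∀ y ∈ N, x * y = y * x)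
    (hidx : N.index.Prime) {x y w : G} (hxN : x ∉ N) (hy : Commute y x) (hw : Commute w x) :
    Commute y w := by
  obtain ⟨z, hz, k, rfl⟩ := exists_mem_center_mul_zpow_eq hN hab hidx hxN hy
  exact Commute.mul_left (mem_center_iff.mp hz w).symm (hw.symm.zpow_left k)

theorem centralizer_eq_centralizer_iff (hN : N.Normal)
    (hab : ∀ x ∈ N, ∀ y ∈ N, x * y = y * x) (hidx : N.index.Prime) {x y : G} (hxN : x ∉ N)
    (hyN : y ∉ N) : centralizer {x} = centralizer {y} ↔ Commute x y := by
  constructor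
  · intro h
    exact mem_centralizer_singleton_iff.mp (h ▸ mem_centralizer_singleton_iff.mpr rfl)
  · intro h
    ext g
    simp only [mem_centralizer_singleton_iff]
    exact ⟨fun hg => commute_of_commute hN hab hidx hxN hg h.symm,
      fun hg => commute_of_commute hN hab hidx hyN hg h⟩

/-- The homomorphism `n ↦ ⁅t, n⁆` on a normal abelian subgroup. -/
def commutatorHom (hN : N.Normal) (hab : ∀ x ∈ N, ∀ y ∈ N, x * y = y * x) (t : G) : N →* G where
  toFun n := ⁅t, (n : G)⁆
  map_one' := by simp
  map_mul' a b := by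
    have h : (a : G)⁻¹ * (t * b * t⁻¹ * (b : G)⁻¹) = t * b * t⁻¹ * (b : G)⁻¹ * (a : G)⁻¹ :=
      hab _ (N.inv_mem a.2) _ (N.mul_mem (hN.conj_mem _ b.2 t) (N.inv_mem b.2))
    simp only [commutatorElement_def, coe_mul, mul_inv_rev]
    rw [mul_assoc (t * a * t⁻¹), h]
    group

theorem commutatorHom_apply (hN : N.Normal) (hab : ∀ x ∈ N, ∀ y ∈ N, x * y = y * x) (t : G)
    (n : N) : commutatorHom hN hab t n = ⁅t, (n : G)⁆ := rfl

theorem normal_range_commutatorHom (hN : N.Normal)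
    (hab : ∀ x ∈ N, ∀ y ∈ N, x * y = y * x) (hidx : N.index.Prime) {t : G} (ht : t ∉ N) :
    (commutatorHom hN hab t).range.Normal := by
  constructor
  rintro _ ⟨n, rfl⟩ g
  obtain ⟨m, hm, k, rfl⟩ := exists_mul_zpow_eq hN hidx ht g
  refine ⟨⟨t ^ k * n * (t ^ k)⁻¹, hN.conj_mem _ n.2 _⟩, ?_⟩
  have hmem : ⁅t, t ^ k * (n : G) * (t ^ k)⁻¹⁆ ∈ N := by
    rw [commutatorElement_def]
    exact N.mul_mem (hN.conj_mem _ (hN.conj_mem _ n.2 _) t)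
      (N.inv_mem (hN.conj_mem _ n.2 _))
  have hconj : t ^ k * ⁅t, (n : G)⁆ * (t ^ k)⁻¹ = ⁅t, t ^ k * (n : G) * (t ^ k)⁻¹⁆ := by
    simp only [commutatorElement_def]
    group
  simp only [commutatorHom_apply]
  calc _ = m * ⁅t, t ^ k * (n : G) * (t ^ k)⁻¹⁆ * m⁻¹ := by
        rw [hab m hm _ hmem, mul_inv_cancel_right]
    _ = _ := by
        rw [← hconj]
        group

theorem range_commutatorHom (hN : N.Normal) (hab : ∀ x ∈ N, ∀ y ∈ N, x * y = y * x)
    (hidx : N.index.Prime) {t : G} (ht : t ∉ N) :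
    (commutatorHom hN hab t).range = _root_.commutator G := by
  apply le_antisymm
  · rintro _ ⟨n, rfl⟩
    exact commutator_mem_commutator (mem_top t) (mem_top (n : G))
  have := normal_range_commutatorHom hN hab hidx ht
  set q := QuotientGroup.mk' (commutatorHom hN hab t).range with hq
  have htn : ∀ n ∈ N, Commute (q t) (q n) := fun n hn => by
    rw [← commutatorElement_eq_one_iff_commute, ← map_commutatorElement, ← MonoidHom.mem_ker, hq,
      QuotientGroup.ker_mk']
    exact ⟨⟨n, hn⟩, rfl⟩
  have hcentral : ∀ x, (∀ n ∈ N, Commute (q n) (q x)) → Commute (q t) (q x) →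
      ∀ g, Commute (q g) (q x) := fun x hn htx g => by
    have h : (centralizer {q x}).comap q = ⊤ :=
      eq_top_of_index_prime hidx (fun n hnN => mem_centralizer_singleton_iff.mpr (hn n hnN)) ht
        (mem_centralizer_singleton_iff.mpr htx)
    exact mem_centralizer_singleton_iff.mp (mem_comap.mp (h ▸ mem_top g))
  have hcomm : ∀ x g, Commute (q g) (q x) := fun x =>
    hcentral x
      (fun n hn => (hcentral n (fun m hm => (Commute.map (hab m hm n hn) q)) (htn n hn) x).symm)
      (hcentral t (fun n hn => (htn n hn).symm) (Commute.refl _) x).symm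
  refine commutator_le.mpr fun a _ b _ => ?_
  rw [← QuotientGroup.ker_mk' (commutatorHom hN hab t).range, MonoidHom.mem_ker,
    map_commutatorElement, commutatorElement_eq_one_iff_commute]
  exact hcomm b a

/-- The centralizers of the elements of `t * N` are in bijection with the commutator subgroup. -/
theorem ncard_range_centralizer_mul (hN : N.Normal)
    (hab : ∀ x ∈ N, ∀ y ∈ N, x * y = y * x) (hidx : N.index.Prime) {t : G} (ht : t ∉ N) :
    (Set.range fun n : N => centralizer {t * (n : G)}).ncard = Nat.card (_root_.commutator G) := by
  rw [← range_commutatorHom hN hab hidx ht]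
  have hker : Setoid.ker (fun n : N => centralizer {t * (n : G)}) =
      Setoid.ker (commutatorHom hN hab t) := by
    ext a b
    rw [Setoid.ker_def, Setoid.ker_def, centralizer_eq_centralizer_iff hN hab hidx
      (fun h => ht ((N.mul_mem_cancel_right a.2).mp h))
      (fun h => ht ((N.mul_mem_cancel_right b.2).mp h))]
    have hac : Commute (a : G) ((a : G)⁻¹ * b) :=
      hab _ a.2 _ (N.mul_mem (N.inv_mem a.2) b.2)
    have hb : t * (b : G) = t * a * ((a : G)⁻¹ * b) := by group
    rw [← inv_mul_eq_one, ← map_inv,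
      ← map_mul, commutatorHom_apply, commutatorElement_eq_one_iff_commute, hb]
    constructor
    · intro h
      have hta : Commute (t * a) ((a : G)⁻¹ * b) := by
        simpa only [inv_mul_cancel_left] using (Commute.refl (t * (a : G))).inv_right.mul_right h
      simpa only [mul_inv_cancel_right, coe_mul, coe_inv] using hta.mul_left hac.inv_left
    · exact fun h => (Commute.refl _).mul_right (h.mul_left hac)
  exact Nat.card_congr ((Setoid.quotientKerEquivRange _).symm.trans
    ((Quotient.congrRight fun a b => by rw [hker]).trans (Setoid.quotientKerEquivRange _)))

theorem commute_of_le_center (hidx : N.index.Prime) (h : N ≤ center G) (a b : G) :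
    a * b = b * a := by
  obtain ⟨t, ht⟩ := exists_notMem_of_index_prime hidx
  have htop : centralizer {t} = ⊤ := eq_top_of_index_prime hidx
    (fun n hn => mem_centralizer_singleton_iff.mpr (mem_center_iff.mp (h hn) t).symm) ht
    (mem_centralizer_singleton_iff.mpr rfl)
  have hc : center G = ⊤ := eq_top_of_index_prime hidx h ht
    (mem_center_iff.mpr fun g => mem_centralizer_singleton_iff.mp (htop ▸ mem_top g))
  exact mem_center_iff.mp (hc ▸ mem_top b) a

theorem centralizer_singleton_eq_top_iff {x : G} : centralizer {x} = ⊤ ↔ x ∈ center G := by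
  simp [eq_top_iff', mem_centralizer_singleton_iff, mem_center_iff]

theorem centralizer_singleton_eq_of_notMem_center (hab : ∀ x ∈ N, ∀ y ∈ N, x * y = y * x)
    (hidx : N.index.Prime) {x : G} (hx : x ∈ N) (hxc : x ∉ center G) : centralizer {x} = N := by
  refine le_antisymm (fun y hy => ?_) fun n hn => mem_centralizer_singleton_iff.mpr (hab n hn x hx)
  by_contra hyN
  exact hxc (mem_center_of_commute hab hidx hyN hx (mem_centralizer_singleton_iff.mp hy).symm)

theorem notMem_center_of_notMem (hna : ¬ ∀ a b : G, a * b = b * a)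
    (hab : ∀ x ∈ N, ∀ y ∈ N, x * y = y * x) (hidx : N.index.Prime) {x : G} (hx : x ∉ N) :
    x ∉ center G := fun hxc =>
  hna (commute_of_le_center hidx fun n hn =>
    mem_center_of_commute hab hidx hx hn (mem_center_iff.mp hxc n))

theorem cent_eq_insert (hna : ¬ ∀ a b : G, a * b = b * a) (hN : N.Normal)
    (hab : ∀ x ∈ N, ∀ y ∈ N, x * y = y * x) (hidx : N.index.Prime) {t : G} (ht : t ∉ N) :
    Cent G = insert ⊤ (insert N (Set.range fun n : N => centralizer {t * (n : G)})) := by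
  ext H
  simp only [Cent, Set.mem_insert_iff, Set.mem_range]
  constructor
  · rintro ⟨x, rfl⟩
    by_cases hxc : x ∈ center G
    · exact Or.inl (centralizer_singleton_eq_top_iff.mpr hxc)
    by_cases hx : x ∈ N
    · exact Or.inr (Or.inl (centralizer_singleton_eq_of_notMem_center hab hidx hx hxc))
    · obtain ⟨n, hn, k, hk⟩ := exists_mul_zpow_eq hN hidx hx t
      have hxk : t * (t⁻¹ * n⁻¹ * t) = x ^ k := by
        rw [← hk]
        group
      have hmem : t⁻¹ * n⁻¹ * t ∈ N := by
        simpa using hN.conj_mem _ (N.inv_mem hn) t⁻¹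
      refine Or.inr (Or.inr ⟨⟨_, hmem⟩, ?_⟩)
      rw [centralizer_eq_centralizer_iff hN hab hidx
        (fun h => ht ((N.mul_mem_cancel_right hmem).mp h)) hx, hxk]
      exact (Commute.refl x).zpow_left k
  · rintro (rfl | rfl | ⟨n, rfl⟩)
    · exact ⟨1, centralizer_singleton_eq_top_iff.mpr (one_mem _)⟩
    · obtain ⟨n, hn, hnc⟩ := SetLike.not_le_iff_exists.mp
        fun h => hna (commute_of_le_center hidx h)
      exact ⟨n, centralizer_singleton_eq_of_notMem_center hab hidx hn hnc⟩
    · exact ⟨_, rfl⟩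

end Subgroup

/-- A finite non-abelian group with an abelian normal subgroup of prime index is a
CG-group. -/
theorem isCGGroup_of_abelian_normal_prime_index (G : Type*) [Group G] [Finite G]
    (hna : ¬ ∀ a b : G, a * b = b * a)
    (N : Subgroup G) (hN : N.Normal)
    (hab : ∀ x ∈ N, ∀ y ∈ N, x * y = y * x)
    (hidx : N.index.Prime) :
    IsCGGroup G := by
  obtain ⟨t, ht⟩ := Subgroup.exists_notMem_of_index_prime hidx
  have htn : ∀ n : N, t * (n : G) ∉ N := fun n h => ht ((N.mul_mem_cancel_right n.2).mp h)
  rw [IsCGGroup, Subgroup.cent_eq_insert hna hN hab hidx ht, Set.ncard_insert_of_notMem,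
    Set.ncard_insert_of_notMem, Subgroup.ncard_range_centralizer_mul hN hab hidx ht]
  · rintro ⟨n, hn : Subgroup.centralizer {_} = N⟩
    exact htn n (hn.le (Subgroup.mem_centralizer_singleton_iff.mpr rfl))
  · rintro (h | ⟨n, hn⟩)
    · exact ht (h ▸ Subgroup.mem_top t)
    · exact Subgroup.notMem_center_of_notMem hna hab hidx (htn n)
        (Subgroup.centralizer_singleton_eq_top_iff.mp hn)
end

section
/- Let G be a finite Frobenius group with kernel K and complement H, and suppose that the kernel K is cyclic. Then G is a CG-group. -/
/-- `G` is a Frobenius group with kernel `K` and complement `H`: `K` is a nontrivial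
proper normal subgroup, `H` is a nontrivial subgroup, `K ∩ H = 1`, `KH = G`, and the
centralizer of every nonidentity element of `K` is contained in `K`. -/
def IsFrobeniusGroupWith (G : Type*) [Group G] (K H : Subgroup G) : Prop :=
  K ≠ ⊥ ∧ K ≠ ⊤ ∧ K.Normal ∧ H ≠ ⊥ ∧ K ⊓ H = ⊥ ∧
    (∀ g : G, ∃ k ∈ K, ∃ h ∈ H, g = k * h) ∧
    ∀ k ∈ K, k ≠ 1 → Subgroup.centralizer {k} ≤ K

namespace IsFrobeniusGroupWith

variable {G : Type*} [Group G] {K H : Subgroup G}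

theorem eq_one_of_commute (hF : IsFrobeniusGroupWith G K H) {x k : G} (hx : x ∉ K)
    (hk : k ∈ K) (h : k * x = x * k) : k = 1 := by
  by_contra hk1
  exact hx (hF.2.2.2.2.2.2 k hk hk1 (Subgroup.mem_centralizer_singleton_iff.2 h.symm))

theorem notMem_kernel (hF : IsFrobeniusGroupWith G K H) {h : G} (hh : h ∈ H) (h1 : h ≠ 1) :
    h ∉ K := fun hK => h1 (by
  have : h ∈ K ⊓ H := ⟨hK, hh⟩
  rwa [hF.2.2.2.2.1, Subgroup.mem_bot] at this)

/-- Conjugates of `x ∉ K` by distinct elements of `K` are distinct. -/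
theorem conj_injOn (hF : IsFrobeniusGroupWith G K H) {x : G} (hx : x ∉ K) {k l : G}
    (hk : k ∈ K) (hl : l ∈ K) (h : k * x * k⁻¹ = l * x * l⁻¹) : k = l := by
  have hlk : l⁻¹ * k = 1 := by
    refine hF.eq_one_of_commute hx (K.mul_mem (K.inv_mem hl) hk) ?_
    calc l⁻¹ * k * x = l⁻¹ * (k * x * k⁻¹) * k := by group
      _ = x * (l⁻¹ * k) := by rw [h]; group
  exact (inv_mul_eq_one.1 hlk).symm

/-- Every element of the kernel is a commutator `[k, x]` with `k` in the kernel. -/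
theorem exists_commutator_eq [Finite G] (hF : IsFrobeniusGroupWith G K H) {x : G} (hx : x ∉ K)
    {y : G} (hy : y ∈ K) : ∃ k ∈ K, k * x * k⁻¹ * x⁻¹ = y := by
  have hN := hF.2.2.1
  let f : K → K := fun k => ⟨k * x * k⁻¹ * x⁻¹, by
    have := K.mul_mem k.2 (hN.conj_mem _ (K.inv_mem k.2) x)
    simpa only [mul_assoc, Subgroup.coe_inv] using this⟩
  have hf : Function.Injective f := fun k l h =>
    Subtype.ext (hF.conj_injOn hx k.2 l.2 (mul_right_cancel (congrArg Subtype.val h)))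
  obtain ⟨k, hk⟩ := Finite.surjective_of_injective hf ⟨y, hy⟩
  exact ⟨k, k.2, congrArg Subtype.val hk⟩

theorem commutator_le_kernel (hF : IsFrobeniusGroupWith G K H) (hK : IsCyclic K) :
    commutator G ≤ K := by
  have hN := hF.2.2.1
  obtain ⟨⟨z, hz⟩, hgen⟩ := hK.exists_generator
  have hpow : ∀ y ∈ K, ∃ n : ℤ, z ^ n = y := fun y hy => by
    obtain ⟨n, hn⟩ := Subgroup.mem_zpowers_iff.1 (hgen ⟨y, hy⟩)
    exact ⟨n, congrArg Subtype.val hn⟩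
  have hz1 : z ≠ 1 := by
    rintro rfl
    refine hF.1 (K.eq_bot_iff_forall.2 fun y hy => ?_)
    obtain ⟨n, rfl⟩ := hpow y hy
    exact one_zpow n
  rw [commutator_def, Subgroup.commutator_le]
  intro g _ h _
  obtain ⟨a, ha⟩ := hpow _ (hN.conj_mem z hz g⁻¹)
  obtain ⟨b, hb⟩ := hpow _ (hN.conj_mem z hz h⁻¹)
  rw [inv_inv] at ha hb
  have key : g⁻¹ * (h⁻¹ * z * h) * g = h⁻¹ * (g⁻¹ * z * g) * h := by
    have conj_zpow' : ∀ (x : G) (n : ℤ), x⁻¹ * z ^ n * x = (x⁻¹ * z * x) ^ n := fun x n => by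
      simpa using (conj_zpow (i := n) (a := x⁻¹) (b := z)).symm
    rw [← hb, ← ha, conj_zpow', conj_zpow', ← ha, ← hb, ← zpow_mul, ← zpow_mul, mul_comm]
  refine hF.2.2.2.2.2.2 z hz hz1 (Subgroup.mem_centralizer_singleton_iff.2 ?_)
  rw [commutatorElement_def]
  have key' : z * (g * h * g⁻¹ * h⁻¹) = g * h * (h⁻¹ * (g⁻¹ * z * g) * h) * g⁻¹ * h⁻¹ := by group
  rw [key', ← key]
  group

theorem commutator_eq_kernel [Finite G] (hF : IsFrobeniusGroupWith G K H) (hK : IsCyclic K) :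
    commutator G = K := by
  refine le_antisymm (hF.commutator_le_kernel hK) fun y hy => ?_
  obtain ⟨x, -, hx⟩ := SetLike.exists_of_lt (lt_top_iff_ne_top.2 hF.2.1)
  obtain ⟨k, -, rfl⟩ := hF.exists_commutator_eq hx hy
  exact Subgroup.commutator_mem_commutator (Subgroup.mem_top k) (Subgroup.mem_top x)

theorem centralizer_kernel (hF : IsFrobeniusGroupWith G K H) (hK : IsCyclic K) {k : G}
    (hk : k ∈ K) (hk1 : k ≠ 1) : Subgroup.centralizer {k} = K := by
  refine le_antisymm (hF.2.2.2.2.2.2 k hk hk1) fun y hy => ?_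
  exact Subgroup.mem_centralizer_singleton_iff.2
    (congrArg Subtype.val (hK.isMulCommutative.is_comm.comm (⟨y, hy⟩ : K) ⟨k, hk⟩))

theorem centralizer_complement (hF : IsFrobeniusGroupWith G K H) (hK : IsCyclic K) {h : G}
    (hh : h ∈ H) (h1 : h ≠ 1) : Subgroup.centralizer {h} = H := by
  have hcomm : ∀ a ∈ H, a * h = h * a := fun a ha => by
    rw [← commutatorElement_eq_one_iff_mul_comm, ← Subgroup.mem_bot, ← hF.2.2.2.2.1]
    refine ⟨hF.commutator_le_kernel hK (Subgroup.commutator_mem_commutator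
      (Subgroup.mem_top a) (Subgroup.mem_top h)), ?_⟩
    rw [commutatorElement_def]
    exact H.mul_mem (H.mul_mem (H.mul_mem ha hh) (H.inv_mem ha)) (H.inv_mem hh)
  ext g
  rw [Subgroup.mem_centralizer_singleton_iff]
  refine ⟨fun hg => ?_, hcomm g⟩
  obtain ⟨k, hk, a, ha, rfl⟩ := hF.2.2.2.2.2.1 g
  have hk1 : k = 1 := by
    refine hF.eq_one_of_commute (hF.notMem_kernel hh h1) hk (mul_right_cancel (b := a) ?_)
    rw [mul_assoc, ← hcomm a ha, ← mul_assoc, hg, mul_assoc]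
  rwa [hk1, one_mul]

theorem cent_eq [Finite G] (hF : IsFrobeniusGroupWith G K H) (hK : IsCyclic K) {h : G}
    (hh : h ∈ H) (h1 : h ≠ 1) :
    Cent G = insert ⊤ (insert K
      (Set.range fun k : K => Subgroup.centralizer {(k : G) * h * (k : G)⁻¹})) := by
  apply Set.Subset.antisymm
  · rintro _ ⟨x, rfl⟩
    by_cases hx : x ∈ K
    · by_cases hx1 : x = 1
      · left
        simp [hx1, Subgroup.eq_top_iff', Subgroup.mem_centralizer_singleton_iff]
      · exact Or.inr (Or.inl (hF.centralizer_kernel hK hx hx1))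
    · right; right
      obtain ⟨k, hk, a, ha, rfl⟩ := hF.2.2.2.2.2.1 x
      have haK : a ∉ K := fun h => hx (K.mul_mem hk h)
      obtain ⟨l, hl, hlk⟩ := hF.exists_commutator_eq haK hk
      have ha1 : a ≠ 1 := fun h => haK (h ▸ K.one_mem)
      have hconj : ∀ b ∈ H, b ≠ 1 → ∀ g,
          g ∈ Subgroup.centralizer {l * b * l⁻¹} ↔ l⁻¹ * g * l ∈ H := fun b hb hb1 g => by
        rw [← hF.centralizer_complement hK hb hb1, Subgroup.mem_centralizer_singleton_iff,
          Subgroup.mem_centralizer_singleton_iff, ← mul_right_inj l⁻¹, ← mul_left_inj l]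
        simp [mul_assoc]
      refine ⟨⟨l, hl⟩, Subgroup.ext fun g => ?_⟩
      have : k * a = l * a * l⁻¹ := by rw [← hlk]; group
      simp only [this]
      rw [hconj h hh h1, hconj a ha ha1]
  · refine Set.insert_subset ⟨1, ?_⟩ (Set.insert_subset ?_ ?_)
    · simp [Subgroup.eq_top_iff', Subgroup.mem_centralizer_singleton_iff]
    · obtain ⟨k, hk, hk1⟩ := K.bot_or_exists_ne_one.resolve_left hF.1
      exact ⟨k, hF.centralizer_kernel hK hk hk1⟩
    · rintro _ ⟨k, rfl⟩
      exact ⟨_, rfl⟩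

/-- Elements outside `K` in the same coset of `K` with equal centralizers are equal. -/
theorem eq_of_centralizer_eq (hF : IsFrobeniusGroupWith G K H) {x y : G} (hx : x ∉ K)
    (hyx : y * x⁻¹ ∈ K) (h : Subgroup.centralizer {x} = Subgroup.centralizer {y}) : x = y := by
  have hxy : y * x = x * y := Subgroup.mem_centralizer_singleton_iff.1
    (h ▸ Subgroup.mem_centralizer_singleton_iff.2 rfl)
  refine (mul_inv_eq_one.1 (hF.eq_one_of_commute hx hyx ?_)).symm
  rw [← mul_assoc, ← hxy]
  group

end IsFrobeniusGroupWith

/-- A finite Frobenius group with cyclic kernel is a CG-group. -/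
theorem frobenius_cyclic_kernel_isCGGroup (G : Type*) [Group G] [Finite G]
    (K H : Subgroup G) (hFrob : IsFrobeniusGroupWith G K H) (hK : IsCyclic K) :
    IsCGGroup G := by
  have hN := hFrob.2.2.1
  obtain ⟨h, hh, h1⟩ := H.bot_or_exists_ne_one.resolve_left hFrob.2.2.2.1
  have hhK := hFrob.notMem_kernel hh h1
  have hconj : ∀ k ∈ K, k * h * k⁻¹ ∉ K := fun k hk hmem => hhK (by
    simpa [mul_assoc] using hN.conj_mem _ hmem k⁻¹)
  have hinj : Function.Injective
      fun k : K => Subgroup.centralizer {(k : G) * h * (k : G)⁻¹} := fun k l hkl => by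
    refine Subtype.ext (hFrob.conj_injOn hhK k.2 l.2
      (hFrob.eq_of_centralizer_eq (hconj k k.2) ?_ hkl))
    have : (l : G) * h * (l : G)⁻¹ * ((k : G) * h * (k : G)⁻¹)⁻¹ =
        l * (h * ((l : G)⁻¹ * k) * h⁻¹) * (k : G)⁻¹ := by group
    rw [this]
    exact K.mul_mem (K.mul_mem l.2 (hN.conj_mem _ (K.mul_mem (K.inv_mem l.2) k.2) h))
      (K.inv_mem k.2)
  have hself : ∀ x : G, x ∈ Subgroup.centralizer {x} := fun x =>
    Subgroup.mem_centralizer_singleton_iff.2 rfl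
  rw [IsCGGroup, hFrob.commutator_eq_kernel hK, hFrob.cent_eq hK hh h1,
    Set.ncard_insert_of_notMem, Set.ncard_insert_of_notMem, Set.ncard_range_of_injective hinj]
  · rintro ⟨k, hk⟩
    exact hconj k k.2 (hk.le (hself _))
  · rintro (htop | ⟨k, hk⟩)
    · exact hFrob.2.1 htop.symm
    · obtain ⟨z, hz, hz1⟩ := K.bot_or_exists_ne_one.resolve_left hFrob.1
      have hmem : z ∈ Subgroup.centralizer {(k : G) * h * (k : G)⁻¹} := by
        rw [show Subgroup.centralizer {(k : G) * h * (k : G)⁻¹} = ⊤ from hk]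
        exact Subgroup.mem_top z
      exact hz1 (hFrob.eq_one_of_commute (hconj k k.2) hz
        (Subgroup.mem_centralizer_singleton_iff.1 hmem))
end

section
/- Let G be a non-abelian group of order p·q·r, where p, q, r are primes (not necessarily distinct). Then G is a CG-group. -/
namespace CGGroup

open Subgroup
open scoped commutatorElement

variable {G : Type*} [Group G]

/-- For an abelian normal subgroup `A`, the homomorphism `a ↦ ⁅a, y⁆` on `A`. -/
def commHom (A : Subgroup G) [hN : A.Normal] (hA : ∀ a ∈ A, ∀ b ∈ A, a * b = b * a) (y : G) :
    A →* G where
  toFun a := ⁅(a : G), y⁆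
  map_one' := by simp
  map_mul' a b := by
    have h : ((b : G) * (y * (b : G)⁻¹ * y⁻¹)) * (y * (a : G)⁻¹ * y⁻¹) =
        (y * (a : G)⁻¹ * y⁻¹) * (b * (y * (b : G)⁻¹ * y⁻¹)) :=
      hA _ (A.mul_mem b.2 (hN.conj_mem _ (A.inv_mem b.2) y)) _
        (hN.conj_mem _ (A.inv_mem a.2) y)
    calc ⁅((a * b : A) : G), y⁆
        = a * ((b * (y * (b : G)⁻¹ * y⁻¹)) * (y * (a : G)⁻¹ * y⁻¹)) := by
          simp only [commutatorElement_def, coe_mul]; group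
      _ = ⁅(a : G), y⁆ * ⁅(b : G), y⁆ := by
          rw [h]; simp only [commutatorElement_def]; group

@[simp]
theorem commHom_apply (A : Subgroup G) [hN : A.Normal] (hA : ∀ a ∈ A, ∀ b ∈ A, a * b = b * a)
    (y : G) (a : A) : commHom A hA y a = ⁅(a : G), y⁆ := rfl

theorem mem_ker_commHom (A : Subgroup G) [hN : A.Normal] (hA : ∀ a ∈ A, ∀ b ∈ A, a * b = b * a)
    (y : G) (a : A) : a ∈ (commHom A hA y).ker ↔ Commute (a : G) y := by
  rw [MonoidHom.mem_ker, commHom_apply, commutatorElement_eq_one_iff_commute]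

theorem range_commHom_eq_commutator (A : Subgroup G) [hN : A.Normal]
    (hA : ∀ a ∈ A, ∀ b ∈ A, a * b = b * a) (x : G)
    (hx : ∀ g : G, ∃ a ∈ A, ∃ n : ℤ, g = a * x ^ n) :
    (commHom A hA x).range = commutator G := by
  apply le_antisymm
  · rintro _ ⟨a, rfl⟩
    exact commutator_mem_commutator (mem_top _) (mem_top _)
  set K := (commHom A hA x).range with hK
  have hKA : K ≤ A := by
    rintro _ ⟨a, rfl⟩
    rw [commHom_apply, commutatorElement_def, mul_assoc, mul_assoc, ← mul_assoc x]
    exact A.mul_mem a.2 (hN.conj_mem _ (A.inv_mem a.2) x)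
  have hconj (a : A) : x * ⁅(a : G), x⁆ * x⁻¹ = ⁅x * (a : G) * x⁻¹, x⁆ := by
    simp only [commutatorElement_def]; group
  have hAN : A ≤ normalizer (K : Set G) := by
    intro a ha
    rw [mem_normalizer_iff]
    intro k
    constructor
    · intro hk
      rwa [hA a ha k (hKA hk), mul_inv_cancel_right]
    · intro hk
      have h := hA a⁻¹ (A.inv_mem ha) _ (hKA hk)
      have h2 : k = a * k * a⁻¹ := by
        calc k = a⁻¹ * (a * k * a⁻¹) * a := by group
          _ = a * k * a⁻¹ := by rw [h]; group
      rwa [h2]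
  have hxN : x ∈ normalizer (K : Set G) := by
    rw [mem_normalizer_iff]
    intro k
    constructor
    · rintro ⟨a, rfl⟩
      exact ⟨⟨_, hN.conj_mem _ a.2 x⟩, (hconj a).symm⟩
    · rintro ⟨a, ha⟩
      refine ⟨⟨x⁻¹ * a * x, by simpa using hN.conj_mem _ a.2 x⁻¹⟩, ?_⟩
      rw [commHom_apply] at ha ⊢
      have h2 : k = x⁻¹ * (x * k * x⁻¹) * x := by group
      rw [h2, ← ha]
      simp only [commutatorElement_def]; group
  have : K.Normal := by
    rw [← normalizer_eq_top_iff, eq_top_iff]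
    intro g _
    obtain ⟨a, ha, n, rfl⟩ := hx g
    exact mul_mem (hAN ha) (zpow_mem hxN n)
  rw [← Subgroup.Normal.quotient_commutative_iff_commutator_le]
  have hax : ∀ a ∈ A, Commute (a : G ⧸ K) (x : G ⧸ K) := by
    intro a ha
    rw [← commutatorElement_eq_one_iff_commute]
    change ((⁅a, x⁆ : G) : G ⧸ K) = 1
    rw [QuotientGroup.eq_one_iff]
    exact ⟨⟨a, ha⟩, rfl⟩
  have haa : ∀ a ∈ A, ∀ b ∈ A, Commute (a : G ⧸ K) (b : G ⧸ K) := by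
    intro a ha b hb
    change ((a * b : G) : G ⧸ K) = ((b * a : G) : G ⧸ K)
    rw [hA a ha b hb]
  refine ⟨⟨fun u v => ?_⟩⟩
  obtain ⟨g, rfl⟩ := QuotientGroup.mk_surjective u
  obtain ⟨h, rfl⟩ := QuotientGroup.mk_surjective v
  obtain ⟨a, ha, n, rfl⟩ := hx g
  obtain ⟨b, hb, m, rfl⟩ := hx h
  change Commute _ _
  simp only [QuotientGroup.mk_mul, QuotientGroup.mk_zpow]
  exact ((haa a ha b hb).mul_right ((hax a ha).zpow_right m)).mul_left
    (((hax b hb).symm.zpow_left n).mul_right ((Commute.refl _).zpow_zpow n m))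

/-- `G` is a CA-group: centralizers of noncentral elements are abelian. -/
def IsCA (G : Type*) [Group G] : Prop :=
  ∀ x ∉ center G, ∀ a ∈ centralizer {x}, ∀ b ∈ centralizer {x}, a * b = b * a

theorem mem_centralizer_iff_commute (x y : G) : y ∈ centralizer ({x} : Set G) ↔ Commute y x := by
  rw [mem_centralizer_singleton_iff]; rfl

theorem IsCA.centralizer_eq (h : IsCA G) {x y : G} (hx : x ∉ center G) (hy : y ∉ center G)
    (hxy : Commute x y) : centralizer ({x} : Set G) = centralizer {y} := by
  ext z
  constructor
  · intro hz
    exact (mem_centralizer_iff_commute _ _).2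
      (h x hx z hz y ((mem_centralizer_iff_commute _ _).2 hxy.symm))
  · intro hz
    exact (mem_centralizer_iff_commute _ _).2
      (h y hy z hz x ((mem_centralizer_iff_commute _ _).2 hxy))

theorem not_isCyclic_quotient_of_le_center (hna : ¬ ∀ a b : G, a * b = b * a) (A : Subgroup G)
    [A.Normal] [IsCyclic (G ⧸ A)] : ¬ A ≤ center G := by
  intro h
  exact hna (MonoidHom.isMulCommutative_of_isCyclic_of_ker_le_center (QuotientGroup.mk' A)
    (by simpa using h)).is_comm.comm

/-- A CA-group having a normal centralizer with cyclic quotient is a CG-group. -/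
theorem isCGGroup_of_centralizer_normal [Finite G] (hca : IsCA G) (a₀ : G) (ha₀ : a₀ ∉ center G)
    (A : Subgroup G) (hAa : A = centralizer {a₀}) [A.Normal]
    [IsCyclic (G ⧸ A)] : IsCGGroup G := by
  have hA : ∀ a ∈ A, ∀ b ∈ A, a * b = b * a := by rw [hAa]; exact hca a₀ ha₀
  have hZA : center G ≤ A := by
    rw [hAa]; exact center_le_centralizer _
  obtain ⟨u, hu⟩ := IsCyclic.exists_generator (α := G ⧸ A)
  obtain ⟨x, rfl⟩ := QuotientGroup.mk_surjective u
  have hx : ∀ g : G, ∃ a ∈ A, ∃ n : ℤ, g = a * x ^ n := by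
    intro g
    obtain ⟨n, hn⟩ := mem_zpowers_iff.1 (hu g)
    refine ⟨g * (x ^ n)⁻¹, ?_, n, by group⟩
    rw [← QuotientGroup.eq_one_iff]
    simp [hn]
  have hxA : x ∉ A := by
    intro hxA
    apply ha₀
    rw [mem_center_iff]
    intro g
    obtain ⟨a, ha, n, rfl⟩ := hx g
    exact hA _ (mul_mem ha (zpow_mem hxA n)) _
      (hAa ▸ (mem_centralizer_iff_commute _ _).2 (Commute.refl _))
  have hcen : ∀ y ∉ A, ∀ b ∈ A, Commute b y → b ∈ center G := by
    intro y hy b hb hby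
    by_contra hbz
    apply hy
    rw [hAa, hca.centralizer_eq ha₀ hbz (((mem_centralizer_iff_commute _ _).1 (hAa ▸ hb)).symm)]
    exact (mem_centralizer_iff_commute _ _).2 hby.symm
  have hrange := range_commHom_eq_commutator A hA x hx
  have hker : ∀ y ∉ A, (commHom A hA y).ker = (commHom A hA x).ker := by
    intro y hy
    ext a
    rw [mem_ker_commHom, mem_ker_commHom]
    exact ⟨fun h => (mem_center_iff.1 (hcen y hy a a.2 h) x).symm,
      fun h => (mem_center_iff.1 (hcen x hxA a a.2 h) y).symm⟩
  have hrange' : ∀ y ∉ A, (commHom A hA y).range = commutator G := by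
    intro y hy
    apply Subgroup.eq_of_le_of_card_ge
    · rintro _ ⟨a, rfl⟩
      exact commutator_mem_commutator (mem_top _) (mem_top _)
    · rw [← hrange, ← Subgroup.index_ker, ← Subgroup.index_ker, hker y hy]
  let f : A → Subgroup G := fun a => centralizer {(a : G) * x}
  have haxA (a : A) : (a : G) * x ∉ A := fun h => hxA ((A.mul_mem_cancel_left a.2).1 h)
  have hsurj : ∀ y ∉ A, centralizer {y} ∈ Set.range f := by
    intro y hy
    have : ⁅x, y⁆ ∈ (commHom A hA y).range := by
      rw [hrange' y hy]
      exact commutator_mem_commutator (mem_top _) (mem_top _)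
    obtain ⟨a, ha⟩ := this
    refine ⟨a⁻¹, hca.centralizer_eq (fun h => haxA _ (hZA h)) (fun h => hy (hZA h)) ?_⟩
    rw [commHom_apply, commutatorElement_def, commutatorElement_def] at ha
    have ha' : (a : G) * y * (a : G)⁻¹ = x * y * x⁻¹ := by simpa using ha
    change ((a⁻¹ : A) : G) * x * y = y * (((a⁻¹ : A) : G) * x)
    rw [Subgroup.coe_inv]
    calc (a : G)⁻¹ * x * y = (a : G)⁻¹ * (x * y * x⁻¹) * x := by group
      _ = _ := by rw [← ha']; group
  have hCent : Cent G = insert ⊤ (insert A (Set.range f)) := by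
    ext H
    simp only [Cent, Set.mem_insert_iff]
    constructor
    · rintro ⟨y, rfl⟩
      by_cases hyz : y ∈ center G
      · left
        simpa [centralizer_eq_top_iff_subset] using hyz
      · by_cases hyA : y ∈ A
        · right; left
          rw [hAa]
          exact hca.centralizer_eq hyz ha₀ ((mem_centralizer_iff_commute _ _).1 (hAa ▸ hyA))
        · right; right
          exact hsurj y hyA
    · rintro (h | h | ⟨a, h⟩)
      · exact ⟨1, by simp [h, centralizer_eq_top_iff_subset]⟩
      · exact ⟨a₀, (h.trans hAa).symm⟩
      · exact ⟨_, h⟩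
  have hmem (a : A) : (a : G) * x ∈ f a := (mem_centralizer_iff_commute _ _).2 (Commute.refl _)
  have hAf : A ∉ Set.range f := by
    rintro ⟨a, ha⟩
    have := hmem a
    rw [ha] at this
    exact haxA a this
  have htop : (⊤ : Subgroup G) ∉ insert A (Set.range f) := by
    rintro (h | ⟨a, ha⟩)
    · exact hxA (h ▸ mem_top x)
    · apply haxA a
      apply hZA
      have := centralizer_eq_top_iff_subset.1 ha
      simpa using this
  have hff : ∀ a b : A, f a = f b ↔ commHom A hA x a = commHom A hA x b := by
    intro a b
    have key : (a : G) * x = ((a / b : A) : G) * (b * x) := by simp [div_eq_mul_inv, mul_assoc]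
    have hab : Commute ((a / b : A) : G) b := hA _ (a / b).2 _ b.2
    rw [← div_eq_one (b := commHom A hA x b), ← map_div, ← MonoidHom.mem_ker, mem_ker_commHom]
    constructor
    · intro h
      have h1 : Commute ((a : G) * x) (b * x) := (mem_centralizer_iff_commute _ _).1 (by
        have := hmem a
        rwa [h] at this)
      have h2 : Commute ((a / b : A) : G) (b * x) := by
        have : ((a / b : A) : G) = a * x * (b * x)⁻¹ := by simp [div_eq_mul_inv]
        rw [this]
        exact h1.mul_left (Commute.refl _).inv_left
      simpa using hab.inv_right.mul_right h2
    · intro h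
      refine hca.centralizer_eq (fun h => haxA _ (hZA h)) (fun h => haxA _ (hZA h)) ?_
      rw [key]
      exact (hab.mul_right h).mul_left (Commute.refl _)
  have hcardf : (Set.range f).ncard = Nat.card (commutator G) := by
    rw [← hrange]
    have hs : Setoid.ker f = Setoid.ker (commHom A hA x) := by
      ext a b
      exact hff a b
    have e1 := Setoid.quotientKerEquivRange f
    rw [hs] at e1
    exact Nat.card_congr (e1.symm.trans (Setoid.quotientKerEquivRange (commHom A hA x)))
  rw [IsCGGroup, hCent, Set.ncard_insert_of_notMem htop (Set.toFinite _),
    Set.ncard_insert_of_notMem hAf (Set.toFinite _), hcardf]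

/-- A CA-group having an abelian normal subgroup with cyclic quotient is a CG-group. -/
theorem isCGGroup_of_normal [Finite G] (hna : ¬ ∀ a b : G, a * b = b * a) (hca : IsCA G)
    (A : Subgroup G) [hN : A.Normal] (hA : ∀ a ∈ A, ∀ b ∈ A, a * b = b * a)
    [IsCyclic (G ⧸ A)] : IsCGGroup G := by
  obtain ⟨a, haA, ha⟩ := SetLike.not_le_iff_exists.1 (not_isCyclic_quotient_of_le_center hna A)
  have hle : A ≤ centralizer {a} := fun b hb =>
    (mem_centralizer_iff_commute _ _).2 (hA b hb a haA)
  let : CommGroup (G ⧸ A) := IsCyclic.commGroup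
  have : (centralizer {a}).Normal := by
    have : (centralizer {a}) = ((centralizer {a}).map (QuotientGroup.mk' A)).comap
        (QuotientGroup.mk' A) := by
      rw [comap_map_eq_self]
      simpa using hle
    rw [this]
    have : ((centralizer {a}).map (QuotientGroup.mk' A)).Normal := by
      refine ⟨fun n hn g => ?_⟩
      rwa [show g * n * g⁻¹ = n by
        rw [Std.Commutative.comm (op := fun (a b : G ⧸ A) => a * b) g n, mul_inv_cancel_right]]
    infer_instance
  have : IsCyclic (G ⧸ centralizer {a}) :=
    isCyclic_of_surjective (QuotientGroup.map A (centralizer {a}) (MonoidHom.id G) hle) <| by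
      intro y
      obtain ⟨g, rfl⟩ := QuotientGroup.mk_surjective y
      exact ⟨(g : G ⧸ A), rfl⟩
  exact isCGGroup_of_centralizer_normal hca a ha _ rfl

open ArithmeticFunction in
/-- A finite group whose order has at most three prime factors (with multiplicity) is a CA-group. -/
theorem isCA_of_cardFactors_le_three [Finite G] (h : cardFactors (Nat.card G) ≤ 3) : IsCA G := by
  intro x hx
  set H := centralizer ({x} : Set G) with hH
  have h1 : cardFactors (Nat.card G) = cardFactors (Nat.card H) + cardFactors H.index := by
    rw [← cardFactors_mul Nat.card_pos.ne' H.index_ne_zero_of_finite, H.card_mul_index]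
  have h2 : cardFactors (Nat.card H) =
      cardFactors (Nat.card (center H)) + cardFactors (center H).index := by
    rw [← cardFactors_mul Nat.card_pos.ne' (center H).index_ne_zero_of_finite,
      (center H).card_mul_index]
  have h3 : cardFactors H.index ≠ 0 := by
    rw [Ne, cardFactors_eq_zero_iff_eq_zero_or_one]
    rintro (h | h)
    · exact H.index_ne_zero_of_finite h
    · exact hx (by simpa [hH, centralizer_eq_top_iff_subset] using index_eq_one.1 h)
  have h4 : cardFactors (Nat.card (center H)) ≠ 0 := by
    rw [Ne, cardFactors_eq_zero_iff_eq_zero_or_one]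
    rintro (h | h)
    · exact Nat.card_pos.ne' h
    · have hxH : x ∈ H := (mem_centralizer_iff_commute _ _).2 (Commute.refl x)
      have hxc : (⟨x, hxH⟩ : H) ∈ center H := by
        rw [mem_center_iff]
        intro g
        exact Subtype.ext ((mem_centralizer_iff_commute _ _).1 g.2)
      rw [Subgroup.card_eq_one.1 h, mem_bot] at hxc
      have hx1 : x = 1 := congrArg Subtype.val hxc
      exact hx (hx1 ▸ one_mem _)
  have hcyc : IsCyclic (H ⧸ center H) := by
    by_cases h0 : cardFactors (center H).index = 0
    · have : (center H).index = 1 := (cardFactors_eq_zero_iff_eq_zero_or_one.1 h0).resolve_left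
        (center H).index_ne_zero_of_finite
      have : Subsingleton (H ⧸ center H) := (Nat.card_eq_one_iff_unique.1 this).1
      infer_instance
    · have hp : (center H).index.Prime := cardFactors_eq_one_iff_prime.1 (by omega)
      have := Fact.mk hp
      exact isCyclic_of_prime_card (p := (center H).index) rfl
  have hcomm := (MonoidHom.isMulCommutative_of_isCyclic_of_ker_le_center
    (QuotientGroup.mk' (center H)) (by simp)).is_comm.comm
  intro a ha b hb
  exact congrArg Subtype.val (hcomm ⟨a, ha⟩ ⟨b, hb⟩)

theorem isCyclic_quotient_of_index_prime (A : Subgroup G) [A.Normal] (h : A.index.Prime) :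
    IsCyclic (G ⧸ A) :=
  have := Fact.mk h
  isCyclic_of_prime_card (p := A.index) rfl

theorem mul_comm_of_card_eq_prime_sq {p : ℕ} (hp : p.Prime) (A : Subgroup G)
    (h : Nat.card A = p ^ 2) : ∀ a ∈ A, ∀ b ∈ A, a * b = b * a := by
  have := Fact.mk hp
  intro a ha b hb
  exact congrArg Subtype.val
    ((IsPGroup.isMulCommutative_of_card_eq_prime_sq h).is_comm.comm ⟨a, ha⟩ ⟨b, hb⟩)

theorem isCGGroup_of_squarefree [Finite G] (hna : ¬ ∀ a b : G, a * b = b * a) (hca : IsCA G)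
    (h : Squarefree (Nat.card G)) : IsCGGroup G := by
  have := IsZGroup.of_squarefree h
  have := IsZGroup.isCyclic_commutator (G := G)
  have : IsCyclic (G ⧸ commutator G) := IsZGroup.isCyclic_abelianization (G := G)
  refine isCGGroup_of_normal hna hca (commutator G) ?_
  intro a ha b hb
  let _ : CommGroup (commutator G) := IsCyclic.commGroup
  exact congrArg Subtype.val (mul_comm (⟨a, ha⟩ : commutator G) ⟨b, hb⟩)

theorem isCGGroup_of_card_sq_mul_prime [Finite G] (hna : ¬ ∀ a b : G, a * b = b * a)
    (hca : IsCA G) {p q : ℕ} (hp : p.Prime) (hq : q.Prime) (h : Nat.card G = p ^ 2 * q) :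
    IsCGGroup G := by
  have := Fact.mk hp
  have := Fact.mk hq
  suffices hmain : (∃ A : Subgroup G, A.Normal ∧ Nat.card A = p ^ 2) ∨
      (p ≠ q ∧ ∃ Q : Subgroup G, Q.Normal ∧ Nat.card Q = q) by
    rcases hmain with ⟨A, hN, hA⟩ | ⟨hpq, Q, hN, hQ⟩
    · have hi : A.index = q := by
        have h1 := A.card_mul_index
        rw [hA, h] at h1
        exact Nat.eq_of_mul_eq_mul_left (pow_pos hp.pos 2) h1
      have := isCyclic_quotient_of_index_prime A (hi ▸ hq)
      exact isCGGroup_of_normal hna hca A (mul_comm_of_card_eq_prime_sq hp A hA)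
    · have hQc : ¬ Q ≤ center G := by
        intro hQc
        obtain ⟨P, hP⟩ := Sylow.exists_subgroup_card_pow_prime p (n := 2) (h ▸ dvd_mul_right _ _)
        have hPc : P ≤ center G := by
          intro y hy
          have h1 : P ≤ centralizer {y} := fun z hz =>
            (mem_centralizer_iff_commute _ _).2
              (mul_comm_of_card_eq_prime_sq hp P hP z hz y hy)
          have h2 : Q ≤ centralizer {y} := hQc.trans (center_le_centralizer _)
          have h3 : Nat.card G ∣ Nat.card (centralizer {y}) := by
            rw [h]
            refine Nat.Coprime.mul_dvd_of_dvd_of_dvd ?_ (hP ▸ card_dvd_of_le h1)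
              (hQ ▸ card_dvd_of_le h2)
            exact Nat.Coprime.pow_left 2 ((Nat.coprime_primes hp hq).2 hpq)
          have h4 := Subgroup.eq_top_of_le_card _ (Nat.le_of_dvd Nat.card_pos h3)
          simpa [centralizer_eq_top_iff_subset] using h4
        have h3 : Nat.card G ∣ Nat.card (center G) := by
          rw [h]
          refine Nat.Coprime.mul_dvd_of_dvd_of_dvd ?_ (hP ▸ card_dvd_of_le hPc)
            (hQ ▸ card_dvd_of_le hQc)
          exact Nat.Coprime.pow_left 2 ((Nat.coprime_primes hp hq).2 hpq)
        have h4 := Subgroup.eq_top_of_le_card _ (Nat.le_of_dvd Nat.card_pos h3)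
        exact hna fun a b => (mem_center_iff.1 (h4 ▸ mem_top b : b ∈ center G) a)
      obtain ⟨a, haQ, ha⟩ := SetLike.not_le_iff_exists.1 hQc
      have hle : (MulAut.conjNormal (H := Q)).ker ≤ centralizer {a} := by
        intro g hg
        have h1 : g * a * g⁻¹ = a := by
          rw [← MulAut.conjNormal_apply g (⟨a, haQ⟩ : Q), MonoidHom.mem_ker.1 hg, MulAut.one_apply]
        exact (mem_centralizer_iff_commute _ _).2 (mul_inv_eq_iff_eq_mul.1 h1)
      have hQcyc : IsCyclic Q := isCyclic_of_prime_card hQ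
      have : IsCyclic (MulAut Q) := by
        have hu : IsCyclic (ZMod (Nat.card Q))ˣ := by
          rw [hQ]
          exact ZMod.isCyclic_units_prime hq
        exact isCyclic_of_injective (IsCyclic.mulAutMulEquiv Q).toMonoidHom
          (IsCyclic.mulAutMulEquiv Q).injective
      have : IsCyclic (G ⧸ (MulAut.conjNormal (H := Q)).ker) :=
        isCyclic_of_injective _ (QuotientGroup.kerLift_injective (MulAut.conjNormal (H := Q)))
      exact isCGGroup_of_normal hna hca (MulAut.conjNormal (H := Q)).ker
        fun b hb c hc => hca a ha b (hle hb) c (hle hc)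
  rcases eq_or_ne p q with rfl | hpq
  · left
    obtain ⟨A, hA⟩ := Sylow.exists_subgroup_card_pow_prime (G := G) p (n := 2)
      (h ▸ dvd_mul_right _ _)
    refine ⟨A, normal_of_index_eq_minFac_card ?_, hA⟩
    have h1 := A.card_mul_index
    rw [hA, h] at h1
    rw [Nat.eq_of_mul_eq_mul_left (pow_pos hp.pos 2) h1, h, ← pow_succ, hp.pow_minFac (by simp)]
  obtain ⟨Q⟩ : Nonempty (Sylow q G) := inferInstance
  have hQ : Nat.card Q = q := by
    rw [Q.card_eq_multiplicity, h, Nat.factorization_mul (pow_pos hp.pos 2).ne' hq.ne_zero,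
      hp.factorization_pow, hq.factorization]
    simp [hpq]
  have key (hc : normalizer ((Q : Subgroup G) : Set G) ≤
      centralizer ((Q : Subgroup G) : Set G)) :
      ∃ A : Subgroup G, A.Normal ∧ Nat.card A = p ^ 2 := by
    refine ⟨(MonoidHom.transferSylow Q hc).ker, inferInstance, ?_⟩
    have h1 := (MonoidHom.ker_transferSylow_isComplement' Q hc).card_mul_card
    have hQ' : Nat.card (Q : Subgroup G) = q := hQ
    rw [hQ', h] at h1
    exact Nat.eq_of_mul_eq_mul_right hq.pos h1
  have hQcyc : IsCyclic Q := isCyclic_of_prime_card hQ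
  rcases hpq.lt_or_gt with hlt | hlt
  · have hi : (normalizer ((Q : Subgroup G) : Set G)).index ∣ p ^ 2 := by
      have h1 := index_dvd_of_le (le_normalizer (H := (Q : Subgroup G)))
      have h2 := (Q : Subgroup G).card_mul_index
      have hQ' : Nat.card (Q : Subgroup G) = q := hQ
      rw [hQ', h, mul_comm] at h2
      rwa [Nat.eq_of_mul_eq_mul_right hq.pos h2] at h1
    obtain ⟨k, hk, hik⟩ := (Nat.dvd_prime_pow hp).1 hi
    interval_cases k
    · right
      refine ⟨hpq, Q, ?_, hQ⟩
      rw [pow_zero, index_eq_one] at hik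
      exact normalizer_eq_top_iff.1 hik
    · have h1 := card_sylow_modEq_one q G
      rw [Q.card_eq_index_normalizer] at h1
      change (normalizer ((Q : Subgroup G) : Set G)).index ≡ 1 [MOD q] at h1
      rw [hik, pow_one] at h1
      have := Nat.ModEq.eq_of_lt_of_lt h1 hlt hq.one_lt
      exact absurd this hp.one_lt.ne'
    · left
      apply key
      have h1 : (Q : Subgroup G) = normalizer ((Q : Subgroup G) : Set G) := by
        apply Subgroup.eq_of_le_of_card_ge le_normalizer
        have h2 := (normalizer ((Q : Subgroup G) : Set G)).card_mul_index
        have hQ' : Nat.card (Q : Subgroup G) = q := hQ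
        rw [hik, h, mul_comm] at h2
        rw [Nat.eq_of_mul_eq_mul_left (pow_pos hp.pos 2) h2, hQ']
      rw [← h1]
      let _ : CommGroup Q := IsCyclic.commGroup
      intro a ha
      rw [mem_centralizer_iff]
      intro b hb
      exact congrArg Subtype.val (mul_comm (⟨b, hb⟩ : Q) ⟨a, ha⟩)
  · left
    apply key
    apply hQcyc.normalizer_le_centralizer
    have hne : Nat.card G ≠ 1 := by
      rw [h]
      exact fun h1 => hq.ne_one (Nat.eq_one_of_mul_eq_one_left h1)
    have hd : (Nat.card G).minFac ∣ p ^ 2 * q := h ▸ Nat.minFac_dvd _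
    have hle : (Nat.card G).minFac ≤ q :=
      Nat.minFac_le_of_dvd hq.two_le (h ▸ dvd_mul_left _ _)
    rcases (Nat.minFac_prime hne).dvd_mul.1 hd with hd | hd
    · have h1 := (Nat.prime_dvd_prime_iff_eq (Nat.minFac_prime hne) hp).1
        ((Nat.minFac_prime hne).dvd_of_dvd_pow hd)
      omega
    · exact (Nat.prime_dvd_prime_iff_eq (Nat.minFac_prime hne) hq).1 hd

end CGGroup

/-- A non-abelian group of order `p·q·r` (`p, q, r` primes, not necessarily distinct)
is a CG-group. -/
theorem isCGGroup_of_card_pqr (G : Type*) [Group G] (p q r : ℕ)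
    (hp : p.Prime) (hq : q.Prime) (hr : r.Prime)
    (hcard : Nat.card G = p * q * r)
    (hna : ¬ ∀ a b : G, a * b = b * a) :
    IsCGGroup G := by
  have : Finite G := Nat.finite_of_card_ne_zero (by
    rw [hcard]; exact (Nat.mul_pos (Nat.mul_pos hp.pos hq.pos) hr.pos).ne')
  have hca : CGGroup.IsCA G := by
    apply CGGroup.isCA_of_cardFactors_le_three
    rw [hcard, ArithmeticFunction.cardFactors_mul (mul_ne_zero hp.ne_zero hq.ne_zero) hr.ne_zero,
      ArithmeticFunction.cardFactors_mul hp.ne_zero hq.ne_zero,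
      ArithmeticFunction.cardFactors_apply_prime hp, ArithmeticFunction.cardFactors_apply_prime hq,
      ArithmeticFunction.cardFactors_apply_prime hr]
  by_cases hpq : p = q
  · exact CGGroup.isCGGroup_of_card_sq_mul_prime hna hca hp hr (by rw [hcard, hpq, sq])
  by_cases hpr : p = r
  · exact CGGroup.isCGGroup_of_card_sq_mul_prime hna hca hp hq (by rw [hcard, ← hpr]; ring)
  by_cases hqr : q = r
  · exact CGGroup.isCGGroup_of_card_sq_mul_prime hna hca hq hp (by rw [hcard, ← hqr]; ring)
  apply CGGroup.isCGGroup_of_squarefree hna hca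
  have cpq := (Nat.coprime_primes hp hq).2 hpq
  have cpr := (Nat.coprime_primes hp hr).2 hpr
  have cqr := (Nat.coprime_primes hq hr).2 hqr
  rw [hcard, Nat.squarefree_mul (Nat.Coprime.mul_left cpr cqr), Nat.squarefree_mul cpq]
  exact ⟨⟨hp.prime.squarefree, hq.prime.squarefree⟩, hr.prime.squarefree⟩
end

section
/- Let G be a non-abelian group of order p⁴, where p is a prime. Then G is a CG-group. -/
open Subgroup
open scoped commutatorElement

section AbelianSubgroupOfPrimeIndex

variable {G : Type*} [Group G] {A : Subgroup G}

theorem Subgroup.eq_top_of_le_of_mem_of_index_prime (hp : A.index.Prime) {H : Subgroup G}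
    (hAH : A ≤ H) {x : G} (hxA : x ∉ A) (hxH : x ∈ H) : H = ⊤ := by
  rcases (Nat.dvd_prime hp).1 (index_dvd_of_le hAH) with h | h
  · exact index_eq_one.1 h
  · have hmul := relIndex_mul_index hAH
    rw [h] at hmul
    have hone : A.relIndex H = 1 := Nat.eq_of_mul_eq_mul_right hp.pos (by rw [hmul, one_mul])
    exact absurd (relIndex_eq_one.1 hone hxH) hxA

theorem Subgroup.exists_zpow_mul_of_index_prime [A.Normal] (hp : A.index.Prime) {x : G}
    (hx : x ∉ A) (g : G) : ∃ k : ℤ, ∃ a ∈ A, x ^ k * a = g := by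
  have htop : zpowers x ⊔ A = ⊤ :=
    eq_top_of_le_of_mem_of_index_prime hp le_sup_right hx
      (mem_sup_left (mem_zpowers x))
  have hg : g ∈ zpowers x ⊔ A := htop ▸ mem_top g
  obtain ⟨y, ⟨k, rfl⟩, a, ha, h⟩ := mem_sup_of_normal_right.1 hg
  exact ⟨k, a, ha, h⟩

theorem Subgroup.mem_center_of_commute_of_index_prime
    (hA : ∀ a ∈ A, ∀ b ∈ A, Commute a b) (hp : A.index.Prime) {x a : G} (hx : x ∉ A)
    (ha : a ∈ A) (h : Commute a x) : a ∈ center G := by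
  have htop : centralizer {a} = ⊤ :=
    eq_top_of_le_of_mem_of_index_prime hp
      (fun b hb => mem_centralizer_singleton_iff.2 (hA b hb a ha).eq) hx
      (mem_centralizer_singleton_iff.2 h.symm.eq)
  exact centralizer_eq_top_iff_subset.1 htop rfl

/-- Outside an abelian normal subgroup of prime index, element centralizers are abelian. -/
theorem Commute.of_commute_of_notMem [A.Normal]
    (hA : ∀ a ∈ A, ∀ b ∈ A, Commute a b) (hp : A.index.Prime) {y u w : G} (hy : y ∉ A)
    (hu : Commute u y) (hw : Commute w y) : Commute u w := by
  obtain ⟨k, a, ha, rfl⟩ := exists_zpow_mul_of_index_prime hp hy u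
  have hay : Commute a y := by
    have := ((Commute.refl y).zpow_left (-k)).mul_left hu
    simpa using this
  have hac := mem_center_iff.1 (mem_center_of_commute_of_index_prime hA hp hy ha hay) w
  exact (hw.symm.zpow_left k).mul_left hac.symm

theorem Subgroup.centralizer_singleton_eq_of_commute [A.Normal]
    (hA : ∀ a ∈ A, ∀ b ∈ A, Commute a b) (hp : A.index.Prime) {y w : G} (hy : y ∉ A)
    (hw : w ∉ A) (h : Commute y w) : centralizer {y} = centralizer {w} := by
  ext u
  rw [mem_centralizer_singleton_iff, mem_centralizer_singleton_iff]
  exact ⟨fun hu => Commute.of_commute_of_notMem hA hp hy hu h.symm,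
    fun hu => Commute.of_commute_of_notMem hA hp hw hu h⟩

/-- The homomorphism `a ↦ ⁅a, x⁆` from an abelian normal subgroup. -/
def commutatorHom (A : Subgroup G) [A.Normal] (hA : ∀ a ∈ A, ∀ b ∈ A, Commute a b) (x : G) :
    A →* G :=
  MonoidHom.mk' (fun a => ⁅(a : G), x⁆) fun a b => by
    have hb : ⁅(b : G), x⁆ ∈ A := commutator_le_left A ⊤ (commutator_mem_commutator b.2 (mem_top x))
    have hab := (hA _ a.2 _ hb).eq
    have ha : ⁅(a : G), x⁆ ∈ A := commutator_le_left A ⊤ (commutator_mem_commutator a.2 (mem_top x))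
    rw [(hA _ ha _ hb).eq]
    calc ⁅((a * b : A) : G), x⁆ = a * ⁅(b : G), x⁆ * (x * (a : G)⁻¹ * x⁻¹) := by
          simp only [commutatorElement_def, coe_mul]; group
      _ = _ := by rw [hab]; simp only [commutatorElement_def]; group

theorem range_commutatorHom [A.Normal] (hA : ∀ a ∈ A, ∀ b ∈ A, Commute a b)
    (hp : A.index.Prime) {x : G} (hx : x ∉ A) :
    (commutatorHom A hA x).range = commutator G := by
  set K := (commutatorHom A hA x).range with hK
  have hmem : ∀ a ∈ A, ⁅a, x⁆ ∈ K := fun a ha => ⟨⟨a, ha⟩, rfl⟩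
  have hKA : K ≤ A := by
    rintro _ ⟨a, rfl⟩
    exact commutator_le_left A ⊤ (commutator_mem_commutator a.2 (mem_top x))
  apply le_antisymm
  · rintro _ ⟨a, rfl⟩
    exact commutator_mem_commutator (mem_top _) (mem_top _)
  have hconj : ∀ g : G, ∀ n ∈ K, g * n * g⁻¹ ∈ K := by
    have hcoe : ∀ a ∈ A, ∀ n ∈ K, a * n * a⁻¹ ∈ K := fun a ha n hn => by
      rw [(hA a ha n (hKA hn)).eq, mul_inv_cancel_right]; exact hn
    have hself : ∀ y : G, (y = x ∨ y = x⁻¹) → ∀ n ∈ K, y * n * y⁻¹ ∈ K := by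
      intro y hy n hn
      obtain ⟨a, rfl⟩ := hn
      have : y * ⁅(a : G), x⁆ * y⁻¹ = ⁅y * a * y⁻¹, x⁆ := by
        rcases hy with rfl | rfl <;> simp only [commutatorElement_def] <;> group
      exact this ▸ hmem _ (Normal.conj_mem inferInstance _ a.2 y)
    have htop : normalizer (K : Set G) = ⊤ := by
      refine eq_top_of_le_of_mem_of_index_prime hp (fun a ha => ?_) hx ?_
      · refine mem_normalizer_iff.2 fun n => ⟨hcoe a ha n, fun h => ?_⟩
        simpa [mul_assoc] using hcoe a⁻¹ (inv_mem ha) _ h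
      · refine mem_normalizer_iff.2 fun n => ⟨hself x (.inl rfl) n, fun h => ?_⟩
        simpa [mul_assoc] using hself x⁻¹ (.inr rfl) _ h
    intro g n hn
    exact (mem_normalizer_iff.1 (htop ▸ mem_top g : g ∈ normalizer (K : Set G)) n).1 hn
  have hN : K.Normal := ⟨fun n hn g => hconj g n hn⟩
  have hAx : ∀ a ∈ A, (a : G ⧸ K) * x = x * a := fun a ha => by
    have h : ((⁅a, x⁆ : G) : G ⧸ K) = 1 := (QuotientGroup.eq_one_iff _).2 (hmem a ha)
    exact commutatorElement_eq_one_iff_mul_comm.1 h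
  have hAA : ∀ a ∈ A, ∀ b ∈ A, (a : G ⧸ K) * b = b * a := fun a ha b hb => by
    rw [← QuotientGroup.mk_mul, (hA a ha b hb).eq, QuotientGroup.mk_mul]
  have key : ∀ z : G, (∀ a ∈ A, (a : G ⧸ K) * z = z * a) → (x : G ⧸ K) * z = z * x →
      ∀ g : G, (g : G ⧸ K) * z = z * g := fun z hz hxz g => by
    have htop : (centralizer {(z : G ⧸ K)}).comap (QuotientGroup.mk' K) = ⊤ :=
      eq_top_of_le_of_mem_of_index_prime hp
        (fun a ha => mem_centralizer_singleton_iff.2 (hz a ha)) hx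
        (mem_centralizer_singleton_iff.2 hxz)
    exact mem_centralizer_singleton_iff.1 (mem_comap.1 (htop ▸ mem_top g))
  have hxc := key x hAx rfl
  have hall : ∀ g h : G, (g : G ⧸ K) * h = h * g := fun g h =>
    key h (fun a ha => (key a (fun b hb => hAA b hb a ha) (hxc a).symm h).symm)
      (hxc h).symm g
  refine commutator_le.2 fun g _ h _ => (QuotientGroup.eq_one_iff _).1 ?_
  exact commutatorElement_eq_one_iff_mul_comm.2 (hall g h)

theorem ncard_centralizers_of_notMem [A.Normal] (hA : ∀ a ∈ A, ∀ b ∈ A, Commute a b)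
    (hp : A.index.Prime) :
    {C : Subgroup G | ∃ y ∉ A, C = centralizer {y}}.ncard = Nat.card (commutator G) := by
  obtain ⟨x, hx⟩ : ∃ x, x ∉ A := by
    by_contra! h
    exact hp.one_lt.ne' (index_eq_one.2 (eq_top_iff.2 fun x _ => h x))
  have hxa : ∀ a ∈ A, x * a ∉ A := fun a ha h => hx ((A.mul_mem_cancel_right ha).1 h)
  have hset : {C : Subgroup G | ∃ y ∉ A, C = centralizer {y}} =
      Set.range fun a : A => centralizer {x * (a : G)} := by
    ext C
    constructor
    · rintro ⟨y, hy, rfl⟩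
      obtain ⟨k, b, hb, h⟩ := exists_zpow_mul_of_index_prime hp hy x
      refine ⟨⟨b⁻¹, inv_mem hb⟩, ?_⟩
      have hk : x * b⁻¹ = y ^ k := by rw [← h, mul_inv_cancel_right]
      have hkA := hxa _ (inv_mem hb)
      refine centralizer_singleton_eq_of_commute hA hp hkA hy ?_
      exact hk ▸ (Commute.refl y).zpow_left k
    · rintro ⟨a, rfl⟩
      exact ⟨_, hxa a a.2, rfl⟩
  have hfib : ∀ a b : A, centralizer {x * (a : G)} = centralizer {x * (b : G)} ↔
      commutatorHom A hA x a = commutatorHom A hA x b := fun a b => by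
    have h1 : commutatorHom A hA x a = commutatorHom A hA x b ↔
        Commute ((a : G)⁻¹ * b) x := by
      rw [← inv_mul_eq_one, ← map_inv, ← map_mul]
      exact commutatorElement_eq_one_iff_mul_comm
    rw [h1]
    constructor
    · intro h
      have hc : Commute (x * a) (x * b) :=
        mem_centralizer_singleton_iff.1
          (h ▸ mem_centralizer_singleton_iff.2 rfl : x * (a : G) ∈ centralizer {x * (b : G)})
      have hd : Commute ((a : G)⁻¹ * b) (x * a) := by
        have := ((Commute.refl (x * (a : G))).inv_left).mul_left hc.symm
        simpa [mul_assoc] using this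
      have hz := mem_center_of_commute_of_index_prime hA hp (hxa a a.2)
        (mul_mem (inv_mem a.2) b.2) hd
      exact (mem_center_iff.1 hz x).symm
    · intro h
      have hz := mem_center_of_commute_of_index_prime hA hp hx
        (mul_mem (inv_mem a.2) b.2) h
      refine centralizer_singleton_eq_of_commute hA hp (hxa a a.2) (hxa b b.2) ?_
      have := (Commute.refl (x * (a : G))).mul_right (mem_center_iff.1 hz (x * a))
      simpa [mul_assoc] using this
  rw [hset, ← range_commutatorHom hA hp hx, ← Nat.card_coe_set_eq]
  have e1 := Nat.card_congr (Setoid.quotientKerEquivRange fun a : A => centralizer {x * (a : G)})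
  have e2 := Nat.card_congr (Setoid.quotientKerEquivRange (commutatorHom A hA x))
  have hker : Setoid.ker (fun a : A => centralizer {x * (a : G)}) =
      Setoid.ker (commutatorHom A hA x) := Setoid.ext hfib
  rw [← e1, hker, e2]
  rfl

/-- A finite non-abelian group with an abelian normal subgroup of prime index is a CG-group. -/
theorem isCGGroup_of_commute_of_index_prime [Finite G] [A.Normal]
    (hA : ∀ a ∈ A, ∀ b ∈ A, Commute a b) (hp : A.index.Prime)
    (hna : ¬ ∀ a b : G, a * b = b * a) : IsCGGroup G := by
  have hcenter : center G ≠ ⊤ := fun h =>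
    hna fun a b => (mem_center_iff.1 (h ▸ mem_top a : a ∈ center G) b).symm
  have hzA : ∀ z ∈ center G, z ∈ A := by
    intro z hz
    by_contra hzA
    refine hcenter (eq_top_of_le_of_mem_of_index_prime hp (fun a ha => ?_) hzA hz)
    exact mem_center_of_commute_of_index_prime hA hp hzA ha (mem_center_iff.1 hz a)
  have htop : ∀ y, centralizer {y} = ⊤ → y ∈ center G := fun y hy =>
    centralizer_eq_top_iff_subset.1 hy rfl
  have hAcent : ∀ a ∈ A, a ∉ center G → centralizer {a} = A := by
    intro a ha hac
    refine le_antisymm (fun u hu => ?_) fun b hb => mem_centralizer_singleton_iff.2 (hA b hb a ha)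
    by_contra huA
    exact hac (mem_center_of_commute_of_index_prime hA hp huA ha
      (mem_centralizer_singleton_iff.1 hu).symm)
  obtain ⟨a, ha, hac⟩ : ∃ a ∈ A, a ∉ center G := by
    by_contra! h
    obtain ⟨x, hx⟩ : ∃ x, x ∉ A := by
      by_contra! h'
      exact hp.one_lt.ne' (index_eq_one.2 (eq_top_iff.2 fun x _ => h' x))
    refine hx (hzA x (htop x ?_))
    exact eq_top_of_le_of_mem_of_index_prime hp
      (fun b hb => mem_centralizer_singleton_iff.2 (mem_center_iff.1 (h b hb) x).symm) hx
      (mem_centralizer_singleton_iff.2 rfl)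
  have hCent : Cent G = insert ⊤ (insert A {C | ∃ y ∉ A, C = centralizer {y}}) := by
    ext C
    constructor
    · rintro ⟨y, rfl⟩
      by_cases hy : y ∈ A
      · by_cases hyc : y ∈ center G
        · exact .inl (centralizer_eq_top_iff_subset.2 (Set.singleton_subset_iff.2 hyc))
        · exact .inr (.inl (hAcent y hy hyc))
      · exact .inr (.inr ⟨y, hy, rfl⟩)
    · rintro (rfl | rfl | ⟨y, -, rfl⟩)
      · exact ⟨1, centralizer_eq_top_iff_subset.2 (Set.singleton_subset_iff.2 (one_mem _))⟩
      · exact ⟨a, hAcent a ha hac⟩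
      · exact ⟨y, rfl⟩
  have hnotA : A ∉ {C : Subgroup G | ∃ y ∉ A, C = centralizer {y}} := by
    rintro ⟨y, hy, h⟩
    exact hy (h ▸ mem_centralizer_singleton_iff.2 rfl)
  have hnottop : ⊤ ∉ insert A {C : Subgroup G | ∃ y ∉ A, C = centralizer {y}} := by
    rintro (h | ⟨y, hy, h⟩)
    · exact hp.one_lt.ne' (index_eq_one.2 h.symm)
    · exact hy (hzA y (htop y h.symm))
  rw [IsCGGroup, hCent, Set.ncard_insert_of_notMem hnottop (Set.toFinite _),
    Set.ncard_insert_of_notMem hnotA (Set.toFinite _), ncard_centralizers_of_notMem hA hp]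

end AbelianSubgroupOfPrimeIndex

/-- An element of the second centre has at most `|Z(G)|` conjugates. -/
theorem Subgroup.index_centralizer_le_card_center {G : Type*} [Group G] [Finite G] {x : G}
    (hx : ∀ y, ⁅x, y⁆ ∈ center G) : (centralizer {x}).index ≤ Nat.card (center G) := by
  let f : G →* center G := MonoidHom.mk' (fun y => ⟨⁅x, y⁆, hx y⟩) fun y z => by
    ext
    have h := mem_center_iff.1 (hx z) y
    calc ⁅x, y * z⁆ = ⁅x, y⁆ * (y * ⁅x, z⁆ * y⁻¹) := by
          simp only [commutatorElement_def]; group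
      _ = _ := by rw [h, mul_inv_cancel_right]; rfl
  have hker : f.ker ≤ centralizer {x} := fun y hy => by
    have h : ⁅x, y⁆ = 1 := congrArg Subtype.val (f.mem_ker.1 hy)
    exact mem_centralizer_singleton_iff.2 (commutatorElement_eq_one_iff_mul_comm.1 h).symm
  calc (centralizer {x}).index ≤ f.ker.index :=
        Nat.le_of_dvd (Nat.pos_of_ne_zero FiniteIndex.index_ne_zero) (index_dvd_of_le hker)
    _ = Nat.card f.range := index_ker f
    _ ≤ Nat.card (center G) := card_le_card_group _

theorem exists_commute_subgroup_index_eq_of_card_p4 {G : Type*} [Group G] {p : ℕ} (hp : p.Prime)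
    (hcard : Nat.card G = p ^ 4) (hna : ¬ ∀ a b : G, a * b = b * a) :
    ∃ A : Subgroup G, A.index = p ∧ ∀ a ∈ A, ∀ b ∈ A, Commute a b := by
  have : Fact p.Prime := ⟨hp⟩
  have : Finite G := Nat.finite_of_card_ne_zero (hcard ▸ pow_ne_zero _ hp.ne_zero)
  have hG : IsPGroup p G := IsPGroup.of_card hcard
  obtain ⟨k, hk0, hk⟩ := IsPGroup.card_center_eq_prime_pow hcard (by norm_num)
  have hcenter : center G ≠ ⊤ := fun h =>
    hna fun a b => (mem_center_iff.1 (h ▸ mem_top a : a ∈ center G) b).symm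
  have : Nontrivial (G ⧸ center G) := QuotientGroup.nontrivial_iff.2 hcenter
  have hcenterQ := (hG.to_quotient (center G)).center_nontrivial
  obtain ⟨⟨q, hq⟩, hq1⟩ := exists_ne (1 : center (G ⧸ center G))
  obtain ⟨x, rfl⟩ := QuotientGroup.mk_surjective q
  have hxZ : x ∉ center G := fun h => hq1 (Subtype.ext ((QuotientGroup.eq_one_iff x).2 h))
  have hx : ∀ y, ⁅x, y⁆ ∈ center G := fun y => (QuotientGroup.eq_one_iff _).1
    (commutatorElement_eq_one_iff_mul_comm.2 (mem_center_iff.1 hq y).symm)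
  set C := centralizer {x} with hC
  obtain ⟨i, hi⟩ := hG.index C
  have hik : i ≤ k := by
    have := index_centralizer_le_card_center hx
    rwa [← hC, hi, hk, Nat.pow_le_pow_iff_right hp.one_lt] at this
  have hi0 : i ≠ 0 := by
    rintro rfl
    rw [pow_zero, index_eq_one] at hi
    exact hxZ (centralizer_eq_top_iff_subset.1 hi rfl)
  obtain ⟨j, hj⟩ := IsPGroup.iff_card.1 (hG.to_subgroup ((center C).map C.subtype))
  have hjcard : Nat.card (center C) = p ^ j := by
    rw [← hj]; exact (card_map_of_injective C.subtype_injective).symm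
  have hlt : center G < (center C).map C.subtype := by
    refine lt_of_le_of_ne (fun z hz => ?_) fun h => hxZ (h ▸ ?_)
    · exact ⟨⟨z, center_le_centralizer _ hz⟩,
        mem_center_iff.2 fun g => Subtype.ext (mem_center_iff.1 hz g), rfl⟩
    · exact ⟨⟨x, mem_centralizer_singleton_iff.2 rfl⟩,
        mem_center_iff.2 fun g => Subtype.ext (mem_centralizer_singleton_iff.1 g.2), rfl⟩
  have hkj : k < j := by
    have h : Nat.card (center G) < Nat.card ((center C).map C.subtype) :=
      Set.ncard_lt_ncard hlt (Set.toFinite _)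
    rwa [hk, hj, Nat.pow_lt_pow_iff_right hp.one_lt] at h
  obtain ⟨l, hl⟩ := (hG.to_subgroup C).index (center C)
  have hsum : j + l + i = 4 := by
    have h1 := (center C).card_mul_index
    have h2 := C.card_mul_index
    rw [← h1, hjcard, hl, hi, hcard, ← pow_add, ← pow_add] at h2
    exact Nat.pow_right_injective hp.two_le h2
  have hi1 : i = 1 := by omega
  have hl1 : l ≤ 1 := by omega
  have : IsCyclic (C ⧸ center C) := isCyclic_of_card_dvd_prime (p := p) (by
    rw [← index_eq_card, hl]
    exact (pow_dvd_pow p hl1).trans (pow_one p).dvd)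
  refine ⟨C, by rw [hi, hi1, pow_one], fun a ha b hb => ?_⟩
  exact congrArg Subtype.val (((QuotientGroup.mk' (center C)).isMulCommutative_of_isCyclic_of_ker_le_center
    (QuotientGroup.ker_mk' _).le).is_comm.comm ⟨a, ha⟩ ⟨b, hb⟩)

/-- A non-abelian group of order `p⁴` (`p` prime) is a CG-group. -/
theorem isCGGroup_of_card_p4 (G : Type*) [Group G] (p : ℕ) (hp : p.Prime)
    (hcard : Nat.card G = p ^ 4)
    (hna : ¬ ∀ a b : G, a * b = b * a) :
    IsCGGroup G := by
  have : Finite G := Nat.finite_of_card_ne_zero (hcard ▸ pow_ne_zero _ hp.ne_zero)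
  obtain ⟨A, hindex, hA⟩ := exists_commute_subgroup_index_eq_of_card_p4 hp hcard hna
  have : A.Normal := normal_of_index_eq_minFac_card (by
    rw [hindex, hcard, hp.pow_minFac (by norm_num)])
  exact isCGGroup_of_commute_of_index_prime hA (hindex ▸ hp) hna
end

section
/- Let G be a finite group with abelian subgroups K and H, both containing the center Z(G), such that K is normal in G, K ∩ H = Z(G), KH = G, and the quotient G/Z(G) is a Frobenius group with kernel K/Z(G) and complement H/Z(G) (i.e., K/Z(G) is a nontrivial proper normal subgroup of G/Z(G), H/Z(G) is nontrivial, (K/Z(G)) ∩ (H/Z(G)) = 1, (K/Z(G))(H/Z(G)) = G/Z(G), and the centralizer in G/Z(G) of every nonidentity element of K/Z(G) is contained in K/Z(G)). Then G is a CG-group. -/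
open Subgroup
open scoped commutatorElement

section

variable {G : Type*} [Group G] {K H : Subgroup G}

/-- For an abelian normal subgroup `K`, the map `k ↦ ⁅k, h⁆` is an endomorphism of `K`. -/
def commutatorEndOfNormal (hKab : ∀ x ∈ K, ∀ y ∈ K, x * y = y * x) (hKn : K.Normal) (h : G) :
    K →* K where
  toFun k := ⟨k * (h * (k : G)⁻¹ * h⁻¹), K.mul_mem k.2 (hKn.conj_mem _ (K.inv_mem k.2) h)⟩
  map_one' := by ext; simp
  map_mul' a b := by
    ext
    have e := hKab (b * (h * (b : G)⁻¹ * h⁻¹))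
      (K.mul_mem b.2 (hKn.conj_mem _ (K.inv_mem b.2) h))
      (h * (a : G)⁻¹ * h⁻¹) (hKn.conj_mem _ (K.inv_mem a.2) h)
    calc (a * b : G) * (h * (a * b : G)⁻¹ * h⁻¹)
        = a * ((b * (h * (b : G)⁻¹ * h⁻¹)) * (h * (a : G)⁻¹ * h⁻¹)) := by group
      _ = a * (h * (a : G)⁻¹ * h⁻¹) * (b * (h * (b : G)⁻¹ * h⁻¹)) := by rw [e]; group

/-- The subgroup `[K, h]` of commutators `⁅k, h⁆` with `k` in an abelian normal subgroup `K`. -/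
def commutatorRange (hKab : ∀ x ∈ K, ∀ y ∈ K, x * y = y * x) (hKn : K.Normal) (h : G) :
    Subgroup G :=
  (commutatorEndOfNormal hKab hKn h).range.map K.subtype

theorem mem_commutatorRange (hKab : ∀ x ∈ K, ∀ y ∈ K, x * y = y * x) (hKn : K.Normal) (h x : G) :
    x ∈ commutatorRange hKab hKn h ↔ ∃ k ∈ K, ⁅k, h⁆ = x := by
  simp only [commutatorRange, Subgroup.mem_map, MonoidHom.mem_range]
  constructor
  · rintro ⟨_, ⟨k, rfl⟩, rfl⟩
    exact ⟨k, k.2, by simp [commutatorEndOfNormal, commutatorElement_def, mul_assoc]⟩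
  · rintro ⟨k, hk, rfl⟩
    exact ⟨_, ⟨⟨k, hk⟩, rfl⟩, by simp [commutatorEndOfNormal, commutatorElement_def, mul_assoc]⟩

theorem commutatorRange_le (hKab : ∀ x ∈ K, ∀ y ∈ K, x * y = y * x) (hKn : K.Normal) (h : G) :
    commutatorRange hKab hKn h ≤ K :=
  Subgroup.map_subtype_le _

theorem commutatorRange_normal (hKab : ∀ x ∈ K, ∀ y ∈ K, x * y = y * x) (hKn : K.Normal)
    (hHab : ∀ x ∈ H, ∀ y ∈ H, x * y = y * x) (hprod : ∀ g : G, ∃ k ∈ K, ∃ h ∈ H, g = k * h)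
    {h : G} (hh : h ∈ H) : (commutatorRange hKab hKn h).Normal := by
  refine ⟨fun n hn g => ?_⟩
  obtain ⟨k, hk, u, hu, rfl⟩ := hprod g
  obtain ⟨a, ha, rfl⟩ := (mem_commutatorRange hKab hKn h n).1 hn
  have hmem : ⁅u * a * u⁻¹, h⁆ ∈ commutatorRange hKab hKn h :=
    (mem_commutatorRange hKab hKn h _).2 ⟨_, hKn.conj_mem a ha u, rfl⟩
  have e : u * ⁅a, h⁆ * u⁻¹ = ⁅u * a * u⁻¹, h⁆ := by
    have huh : u * h * u⁻¹ = h := by rw [hHab u hu h hh, mul_inv_cancel_right]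
    rw [← MulAut.conj_apply u ⁅a, h⁆, map_commutatorElement, MulAut.conj_apply,
      MulAut.conj_apply, huh]
  have e' : k * u * ⁅a, h⁆ * (k * u)⁻¹ = ⁅u * a * u⁻¹, h⁆ := by
    calc k * u * ⁅a, h⁆ * (k * u)⁻¹ = k * (u * ⁅a, h⁆ * u⁻¹) * k⁻¹ := by group
      _ = _ := by
        rw [e, hKab k hk _ (commutatorRange_le hKab hKn h hmem), mul_inv_cancel_right]
  rwa [e']

/-- If `⁅k, h⁆` is central only for central `k`, then `K = [K, h] Z(G)`. -/
theorem exists_mul_eq_of_commutator_mem_center [Finite G]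
    (hKab : ∀ x ∈ K, ∀ y ∈ K, x * y = y * x) (hKn : K.Normal) {h : G}
    (hfix : ∀ k ∈ K, ⁅k, h⁆ ∈ center G → k ∈ center G) {x : G} (hx : x ∈ K) :
    ∃ n ∈ commutatorRange hKab hKn h, ∃ z ∈ center G, n * z = x := by
  set φ := commutatorEndOfNormal hKab hKn h
  have hφ : ∀ k : K, (φ k : G) = ⁅(k : G), h⁆ := fun k => by
    simp [φ, commutatorEndOfNormal, commutatorElement_def, mul_assoc]
  have hker : ∀ k : K, (k : G) ∈ center G → φ k = 1 := fun k hk => by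
    ext
    rw [hφ, OneMemClass.coe_one, commutatorElement_eq_one_iff_mul_comm]
    exact (mem_center_iff.1 hk h).symm
  have hker' : ∀ k : K, φ k = 1 → (k : G) ∈ center G := fun k hk =>
    hfix k k.2 (by rw [← hφ, hk]; exact one_mem _)
  have hdisj : Disjoint φ.range φ.ker := by
    rw [Subgroup.disjoint_def]
    rintro _ ⟨k, rfl⟩ hk
    exact hker k (hfix k k.2 (by rw [← hφ]; exact hker' _ hk))
  have hcard : Nat.card φ.range * Nat.card φ.ker = Nat.card K := by
    rw [← Subgroup.index_ker, mul_comm, Subgroup.card_mul_index]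
  obtain ⟨⟨n, z⟩, hnz⟩ := (isComplement'_of_card_mul_and_disjoint hcard hdisj).2 ⟨x, hx⟩
  exact ⟨n.1, ⟨n.1, n.2, rfl⟩, z.1, hker' _ z.2, congrArg Subtype.val hnz⟩

/-- If `K = [K, h] Z(G)` and `G = KH` with `H` abelian, then the commutator subgroup is `[K, h]`. -/
theorem commutator_eq_commutatorRange
    (hKab : ∀ x ∈ K, ∀ y ∈ K, x * y = y * x) (hKn : K.Normal)
    (hHab : ∀ x ∈ H, ∀ y ∈ H, x * y = y * x) (hZH : center G ≤ H)
    (hprod : ∀ g : G, ∃ k ∈ K, ∃ h ∈ H, g = k * h) {h : G} (hh : h ∈ H)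
    (hK : ∀ x ∈ K, ∃ n ∈ commutatorRange hKab hKn h, ∃ z ∈ center G, n * z = x) :
    commutator G = commutatorRange hKab hKn h := by
  have hN := commutatorRange_normal hKab hKn hHab hprod hh
  apply le_antisymm
  · have hrep : ∀ g : G, ∃ u ∈ H,
        (g : G ⧸ commutatorRange hKab hKn h) = (u : G ⧸ commutatorRange hKab hKn h) := by
      intro g
      obtain ⟨k, hk, u, hu, rfl⟩ := hprod g
      obtain ⟨n, hn, z, hz, rfl⟩ := hK k hk
      refine ⟨z * u, H.mul_mem (hZH hz) hu, ?_⟩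
      rw [mul_assoc, QuotientGroup.mk_mul, (QuotientGroup.eq_one_iff n).2 hn, one_mul]
    rw [commutator_def, Subgroup.commutator_le]
    intro a _ b _
    obtain ⟨u, hu, hau⟩ := hrep a
    obtain ⟨v, hv, hbv⟩ := hrep b
    rw [← QuotientGroup.eq_one_iff, ← QuotientGroup.mk'_apply, map_commutatorElement,
      commutatorElement_eq_one_iff_mul_comm, QuotientGroup.mk'_apply, QuotientGroup.mk'_apply,
      hau, hbv, ← QuotientGroup.mk_mul, ← QuotientGroup.mk_mul, hHab u hu v hv]
  · intro x hx
    obtain ⟨k, -, rfl⟩ := (mem_commutatorRange hKab hKn h x).1 hx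
    exact Subgroup.commutator_mem_commutator (mem_top k) (mem_top h)

/-- If elements of `K` commuting with `u ∈ H` are central, then the centralizer of a conjugate
of `u` is the corresponding conjugate of `H`. -/
theorem mem_centralizer_conj_iff (hHab : ∀ x ∈ H, ∀ y ∈ H, x * y = y * x) (hZH : center G ≤ H)
    (hprod : ∀ g : G, ∃ k ∈ K, ∃ h ∈ H, g = k * h) {u : G} (hu : u ∈ H)
    (hfix : ∀ k ∈ K, k * u = u * k → k ∈ center G) (n x : G) :
    x ∈ centralizer {n * u * n⁻¹} ↔ n⁻¹ * x * n ∈ H := by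
  have hcent : ∀ y : G, y * u = u * y ↔ y ∈ H := by
    refine fun y => ⟨fun hy => ?_, fun hy => hHab y hy u hu⟩
    obtain ⟨k, hk, v, hv, rfl⟩ := hprod y
    refine H.mul_mem (hZH (hfix k hk ?_)) hv
    rwa [mul_assoc, hHab v hv u hu, ← mul_assoc, ← mul_assoc, mul_left_inj] at hy
  rw [mem_centralizer_singleton_iff, ← hcent]
  constructor
  · intro e
    calc n⁻¹ * x * n * u = n⁻¹ * (x * (n * u * n⁻¹)) * n := by group
      _ = u * (n⁻¹ * x * n) := by rw [e]; group
  · intro e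
    calc x * (n * u * n⁻¹) = n * (n⁻¹ * x * n * u) * n⁻¹ := by group
      _ = n * u * n⁻¹ * x := by rw [e]; group

/-- In a quotient Frobenius group, an element commuting modulo the center with a noncentral
element of `K` lies in `K`. -/
theorem mem_of_commutator_mem_center (hZK : center G ≤ K)
    (hFrob : IsFrobeniusGroupWith (G ⧸ center G)
      (K.map (QuotientGroup.mk' (center G))) (H.map (QuotientGroup.mk' (center G))))
    {k g : G} (hk : k ∈ K) (hkZ : k ∉ center G) (hkg : ⁅k, g⁆ ∈ center G) : g ∈ K := by
  obtain ⟨-, -, -, -, -, -, hC⟩ := hFrob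
  have hg : (g : G ⧸ center G) ∈ K.map (QuotientGroup.mk' (center G)) := by
    refine hC (k : G ⧸ center G) ⟨k, hk, rfl⟩ (mt (QuotientGroup.eq_one_iff k).1 hkZ) ?_
    rw [mem_centralizer_singleton_iff]
    rw [← QuotientGroup.eq_one_iff, ← QuotientGroup.mk'_apply, map_commutatorElement,
      commutatorElement_eq_one_iff_mul_comm] at hkg
    exact hkg.symm
  rw [← QuotientGroup.mk'_apply, ← Subgroup.mem_comap, QuotientGroup.comap_map_mk'] at hg
  exact (sup_le hZK le_rfl) hg

theorem exists_mem_notMem_center (hK : K.map (QuotientGroup.mk' (center G)) ≠ ⊥) :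
    ∃ k ∈ K, k ∉ center G := by
  by_contra! hle
  exact hK ((Subgroup.map_eq_bot_iff _).2 (by rwa [QuotientGroup.ker_mk']))

end

/-- If `G/Z(G) = (K/Z(G)) ⋊ (H/Z(G))` is a Frobenius group with `K` and `H` abelian,
then `G` is a CG-group. -/
theorem isCGGroup_of_quotient_frobenius_abelian (G : Type*) [Group G] [Finite G]
    (K H : Subgroup G)
    (hKab : ∀ x ∈ K, ∀ y ∈ K, x * y = y * x)
    (hHab : ∀ x ∈ H, ∀ y ∈ H, x * y = y * x)
    (hZK : Subgroup.center G ≤ K) (hZH : Subgroup.center G ≤ H)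
    (hKn : K.Normal)
    (hKH : K ⊓ H = Subgroup.center G)
    (hprod : ∀ g : G, ∃ k ∈ K, ∃ h ∈ H, g = k * h)
    (hFrob : IsFrobeniusGroupWith (G ⧸ Subgroup.center G)
      (K.map (QuotientGroup.mk' (Subgroup.center G)))
      (H.map (QuotientGroup.mk' (Subgroup.center G)))) :
    IsCGGroup G := by
  have hmem := @mem_of_commutator_mem_center G _ K H hZK hFrob
  obtain ⟨k₀, hk₀, hk₀Z⟩ := exists_mem_notMem_center hFrob.1
  obtain ⟨h, hh, hhZ⟩ := exists_mem_notMem_center hFrob.2.2.2.1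
  have hHK : ∀ u ∈ H, u ∉ center G → u ∉ K := fun u hu huZ huK => huZ (hKH ▸ ⟨huK, hu⟩)
  have hfix : ∀ u ∈ H, u ∉ center G → ∀ k ∈ K, ⁅k, u⁆ ∈ center G → k ∈ center G := by
    intro u hu huZ k hk hku
    by_contra hkZ
    exact hHK u hu huZ (hmem hk hkZ hku)
  have hfix' : ∀ u ∈ H, u ∉ center G → ∀ k ∈ K, k * u = u * k → k ∈ center G := by
    intro u hu huZ k hk hku
    refine hfix u hu huZ k hk ?_
    rw [commutatorElement_eq_one_iff_mul_comm.2 hku]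
    exact one_mem _
  have hcent : ∀ u ∈ H, u ∉ center G → ∀ n x : G,
      x ∈ centralizer {n * u * n⁻¹} ↔ n⁻¹ * x * n ∈ H := fun u hu huZ =>
    mem_centralizer_conj_iff hHab hZH hprod hu (hfix' u hu huZ)
  have hsplit : ∀ u ∈ H, u ∉ center G → ∀ x ∈ K,
      ∃ n ∈ commutatorRange hKab hKn u, ∃ z ∈ center G, n * z = x := fun u hu huZ x hx =>
    exists_mul_eq_of_commutator_mem_center hKab hKn (hfix u hu huZ) hx
  have hcomm : ∀ u ∈ H, u ∉ center G → commutator G = commutatorRange hKab hKn u :=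
    fun u hu huZ =>
      commutator_eq_commutatorRange hKab hKn hHab hZH hprod hu (hsplit u hu huZ)
  have hGK : commutator G ≤ K := hcomm h hh hhZ ▸ commutatorRange_le hKab hKn h
  have htriv : ∀ c ∈ commutator G, c ∈ center G → c = 1 := by
    intro c hc hcZ
    rw [hcomm h hh hhZ, mem_commutatorRange] at hc
    obtain ⟨k, hk, rfl⟩ := hc
    rw [commutatorElement_eq_one_iff_mul_comm]
    exact (mem_center_iff.1 (hfix h hh hhZ k hk hcZ) h).symm
  let f : commutator G → Subgroup G := fun n => centralizer {(n : G) * h * (n : G)⁻¹}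
  have hinj : Function.Injective f := by
    intro n m hnm
    have hx : (n : G) * h * (n : G)⁻¹ ∈ f m := hnm ▸ mem_centralizer_singleton_iff.2 rfl
    rw [hcent h hh hhZ] at hx
    set c : G := (m : G)⁻¹ * n with hc
    have hcG : c ∈ commutator G := mul_mem (inv_mem m.2) n.2
    have hxH : ⁅c, h⁆ ∈ H := by
      convert H.mul_mem hx (H.inv_mem hh) using 1
      rw [hc, commutatorElement_def]
      group
    have hxK : ⁅c, h⁆ ∈ K := hGK (Subgroup.commutator_mem_commutator (mem_top c) (mem_top h))
    have h1 := htriv c hcG (hfix h hh hhZ c (hGK hcG) (hKH ▸ ⟨hxK, hxH⟩))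
    exact Subtype.ext (inv_mul_eq_one.1 h1).symm
  have hcentK : ∀ k ∈ K, k ∉ center G → centralizer {k} = K := by
    refine fun k hk hkZ => le_antisymm (fun g hg => hmem hk hkZ ?_) fun g hg =>
      mem_centralizer_singleton_iff.2 (hKab g hg k hk)
    rw [commutatorElement_eq_one_iff_mul_comm.2 (mem_centralizer_singleton_iff.1 hg).symm]
    exact one_mem _
  have hset : Cent G = insert ⊤ (insert K (Set.range f)) := by
    apply Set.Subset.antisymm
    · rintro _ ⟨x, rfl⟩
      by_cases hxZ : x ∈ center G
      · left
        exact centralizer_eq_top_iff_subset.2 (Set.singleton_subset_iff.2 hxZ)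
      by_cases hxK : x ∈ K
      · exact Or.inr (Or.inl (hcentK x hxK hxZ))
      right; right
      obtain ⟨k, hk, u, hu, rfl⟩ := hprod x
      have huZ : u ∉ center G := fun huZ => hxK (K.mul_mem hk (hZK huZ))
      obtain ⟨n, hn, z, hz, rfl⟩ := hsplit u hu huZ k hk
      obtain ⟨a, ha, rfl⟩ := (mem_commutatorRange hKab hKn u n).1 hn
      obtain ⟨b, hb, w, hw, rfl⟩ := hsplit h hh hhZ a ha
      refine ⟨⟨b, by rwa [hcomm h hh hhZ]⟩, ?_⟩
      have hzu : z * u ∉ center G := fun hzu => huZ ((mul_mem_cancel_left hz).1 hzu)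
      have e : ⁅b * w, u⁆ * z * u = b * (z * u) * b⁻¹ := by
        have ew : w * u * w⁻¹ = u := by
          rw [← mem_center_iff.1 hw u, mul_inv_cancel_right]
        calc ⁅b * w, u⁆ * z * u = b * (w * u * w⁻¹) * b⁻¹ * u⁻¹ * (z * u) := by
              rw [commutatorElement_def]; group
          _ = b * u * b⁻¹ * (u⁻¹ * z) * u := by rw [ew]; group
          _ = b * u * (b⁻¹ * z) := by rw [mem_center_iff.1 hz u⁻¹]; group
          _ = b * (u * z) * b⁻¹ := by rw [mem_center_iff.1 hz b⁻¹]; group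
          _ = b * (z * u) * b⁻¹ := by rw [mem_center_iff.1 hz u]
      ext y
      simp only [f]
      rw [e, hcent h hh hhZ, hcent _ (H.mul_mem (hZH hz) hu) hzu]
    · rintro _ (rfl | rfl | ⟨n, rfl⟩)
      · exact ⟨1, centralizer_eq_top_iff_subset.2 (Set.singleton_subset_iff.2 (one_mem _))⟩
      · exact ⟨k₀, hcentK k₀ hk₀ hk₀Z⟩
      · exact ⟨_, rfl⟩
  have hKf : K ∉ Set.range f := by
    rintro ⟨n, hn⟩
    have hx : (n : G) * h * (n : G)⁻¹ ∈ f n := mem_centralizer_singleton_iff.2 rfl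
    rw [hn] at hx
    exact hHK h hh hhZ (by simpa [mul_assoc] using hKn.conj_mem _ hx (n : G)⁻¹)
  have htop : (⊤ : Subgroup G) ∉ insert K (Set.range f) := by
    rintro (hK | ⟨n, hn⟩)
    · exact hHK h hh hhZ (hK ▸ mem_top h)
    · have hx : (n : G) * k₀ * (n : G)⁻¹ ∈ f n := hn ▸ mem_top _
      rw [hcent h hh hhZ] at hx
      exact hHK k₀ (by simpa [mul_assoc] using hx) hk₀Z hk₀
  rw [IsCGGroup, hset, Set.ncard_insert_of_notMem htop, Set.ncard_insert_of_notMem hKf,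
    Set.ncard_range_of_injective hinj]
end
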